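/- arXiv:1906.00089 — 8 statements merged into one kernel-verified Lean document; each statement's English description precedes it below -/
import Mathlib

section
/- (Siladić's theorem.) For every non-negative integer n, the number of partitions of n into distinct odd parts is equal to the number of partitions λ_1 + ⋯ + λ_s of n (with λ_1 ≥ ⋯ ≥ λ_s ≥ 1) such that no part equals 2, any two consecutive parts satisfy λ_i − λ_{i+1} ≥ 5, and moreover: if λ_i − λ_{i+1} = 5 then λ_i ≡ 1 or 4 (mod 8); if λ_i − λ_{i+1} = 6 then λ_i ≡ 1, 3, 5 or 7 (mod 8); if λ_i − λ_{i+1} = 7 then λ_i ≡ 0, 1, 3, 4, 6 or 7 (mod 8); if λ_i − λ_{i+1} = 8 then λ_i ≡ 0, 1, 3, 4, 5 or 7 (mod 8). -/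
namespace Siladic

open Polynomial

/-- The gap condition between consecutive parts `a`, `b` of a Siladić partition. -/
def Gap (a b : ℕ) : Prop :=
  a - b ≥ 5 ∧
    (a - b = 5 → a % 8 = 1 ∨ a % 8 = 4) ∧
    (a - b = 6 → a % 8 = 1 ∨ a % 8 = 3 ∨ a % 8 = 5 ∨ a % 8 = 7) ∧
    (a - b = 7 → a % 8 = 0 ∨ a % 8 = 1 ∨ a % 8 = 3 ∨ a % 8 = 4 ∨ a % 8 = 6 ∨ a % 8 = 7) ∧
    (a - b = 8 → a % 8 = 0 ∨ a % 8 = 1 ∨ a % 8 = 3 ∨ a % 8 = 4 ∨ a % 8 = 5 ∨ a % 8 = 7)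

theorem lt_of_isChain_cons {r : ℕ → ℕ → Prop} (hr : ∀ a b, r a b → b < a) {a : ℕ} {l : List ℕ}
    (h : (a :: l).IsChain r) : ∀ x ∈ l, x < a := by
  have h' : (a :: l).IsChain (· > ·) := h.imp fun a b hab => hr a b hab
  rw [List.isChain_iff_pairwise, List.pairwise_cons] at h'
  exact h'.1

theorem Gap.lt {a b : ℕ} (h : Gap a b) : b < a := by
  have := h.1
  omega

open Classical in
/-- The lists satisfying the Siladić conditions, with all parts at most `N`. -/
noncomputable def lists : ℕ → Finset (List ℕ)
  | 0 => {[]}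
  | N + 1 => lists N ∪ if N + 1 = 2 then ∅ else
      ((lists N).filter fun l => ∀ b ∈ l.head?, Gap (N + 1) b).image (List.cons (N + 1))

open Classical in
theorem mem_lists {N : ℕ} {l : List ℕ} :
    l ∈ lists N ↔ l.IsChain Gap ∧ (∀ x ∈ l, 0 < x ∧ x ≠ 2) ∧ ∀ x ∈ l, x ≤ N := by
  induction N generalizing l with
  | zero =>
    rcases l with _ | ⟨a, l⟩
    · simp [lists]
    · simp only [lists, Finset.mem_singleton, reduceCtorEq, List.mem_cons, forall_eq_or_imp,
        false_iff]
      omega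
  | succ N ih =>
    rw [lists, Finset.mem_union, ih]
    constructor
    · rintro (⟨h₁, h₂, h₃⟩ | h)
      · exact ⟨h₁, h₂, fun x hx => (h₃ x hx).trans N.le_succ⟩
      · split_ifs at h with hN
        · simp at h
        · simp only [Finset.mem_image, Finset.mem_filter, ih] at h
          obtain ⟨l, ⟨⟨h₁, h₂, h₃⟩, h₄⟩, rfl⟩ := h
          refine ⟨List.isChain_cons.2 ⟨h₄, h₁⟩, ?_, ?_⟩ <;>
            simp only [List.mem_cons, forall_eq_or_imp]
          · exact ⟨⟨N.succ_pos, hN⟩, h₂⟩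
          · exact ⟨le_rfl, fun x hx => (h₃ x hx).trans N.le_succ⟩
    · rintro ⟨h₁, h₂, h₃⟩
      rcases l with _ | ⟨a, l⟩
      · simp
      have hlt := lt_of_isChain_cons (fun _ _ => Gap.lt) h₁
      rcases Nat.lt_or_ge N a with ha | ha
      · obtain rfl : a = N + 1 := le_antisymm (h₃ a (by simp)) ha
        right
        rw [if_neg (h₂ _ (by simp)).2]
        rw [List.isChain_cons] at h₁
        refine Finset.mem_image_of_mem _ (Finset.mem_filter.2 ⟨ih.2 ⟨h₁.2, ?_, ?_⟩, h₁.1⟩)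
        · exact fun x hx => h₂ x (by simp [hx])
        · exact fun x hx => Nat.lt_succ_iff.1 (hlt x hx)
      · refine Or.inl ⟨h₁, h₂, ?_⟩
        simp only [List.mem_cons, forall_eq_or_imp]
        exact ⟨ha, fun x hx => (hlt x hx).le.trans ha⟩

/-- The size of a partition after every odd part is raised by `2 * j` and every even part by
`4 * j`. -/
def size (j : ℕ) (l : List ℕ) : ℕ := (l.map fun a => a + 2 * j * (2 - a % 2)).sum

theorem size_nil (j : ℕ) : size j [] = 0 := rfl

theorem size_cons (j a : ℕ) (l : List ℕ) :
    size j (a :: l) = a + 2 * j * (2 - a % 2) + size j l := by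
  simp [size]

theorem size_zero (l : List ℕ) : size 0 l = l.sum := by
  simp [size]

theorem le_size {j a : ℕ} {l : List ℕ} (h : a ∈ l) : a + 2 * j ≤ size j l := by
  have h₁ : a + 2 * j * (2 - a % 2) ≤ size j l :=
    List.single_le_sum (by simp) _ (List.mem_map_of_mem h)
  have h₂ : 2 * j * 1 ≤ 2 * j * (2 - a % 2) := Nat.mul_le_mul_left _ (by omega)
  omega

open Classical in
/-- The generating function, by `size j`, of the lists with parts at most `N` whose first part
satisfies `p`. -/
noncomputable def genHead (j : ℕ) (p : ℕ → Prop) (N : ℕ) : ℤ[X] :=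
  ∑ l ∈ (lists N).filter (fun l => ∀ b ∈ l.head?, p b), X ^ size j l

/-- The generating function, by `size j`, of the lists with parts at most `N`. -/
noncomputable def gen (j N : ℕ) : ℤ[X] := ∑ l ∈ lists N, X ^ size j l

theorem genHead_zero (j : ℕ) (p : ℕ → Prop) : genHead j p 0 = 1 := by
  simp [genHead, lists, Finset.filter_singleton, size_nil]

theorem genHead_true (j N : ℕ) : genHead j (fun _ => True) N = gen j N := by
  simp [genHead, gen]

open Classical in
theorem genHead_succ (j : ℕ) (p : ℕ → Prop) (N : ℕ) :
    genHead j p (N + 1) = genHead j p N +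
      if p (N + 1) ∧ N + 1 ≠ 2 then
        X ^ (N + 1 + 2 * j * (2 - (N + 1) % 2)) * genHead j (Gap (N + 1)) N else 0 := by
  rw [genHead, lists]
  split_ifs with h₁ h₂ h₂
  · exact absurd h₁ h₂.2
  · simp [genHead]
  · rw [Finset.filter_union, Finset.sum_union]
    · congr 1
      rw [Finset.filter_true_of_mem, Finset.sum_image (fun _ _ _ _ h => (List.cons.inj h).2),
        genHead, Finset.mul_sum]
      · simp only [size_cons, pow_add]
      · simp only [Finset.mem_image]
        rintro _ ⟨l, -, rfl⟩
        simpa using h₂.1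
    · rw [Finset.disjoint_left]
      intro l hl hl'
      simp only [Finset.mem_filter, mem_lists, Finset.mem_image] at hl hl'
      obtain ⟨⟨l, -, rfl⟩, -⟩ := hl'
      have := hl.1.2.2 (N + 1) (by simp)
      omega
  · rw [Finset.filter_union, (Finset.filter_eq_empty_iff (s := Finset.image _ _)).2]
    · simp [genHead]
    · simp only [Finset.mem_image]
      rintro _ ⟨l, -, rfl⟩
      simpa using fun hp => h₂ ⟨hp, h₁⟩

theorem genHead_eq_of_false {j : ℕ} {p : ℕ → Prop} {M N : ℕ} (hMN : M ≤ N)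
    (h : ∀ b, M < b → b ≤ N → ¬ p b) : genHead j p N = genHead j p M := by
  induction N, hMN using Nat.le_induction with
  | base => rfl
  | succ N hN ih =>
    rw [genHead_succ, if_neg fun hp => h _ (by omega) le_rfl hp.1, add_zero]
    exact ih fun b h₁ h₂ => h b h₁ (by omega)

theorem genHead_eq_gen {j : ℕ} {p : ℕ → Prop} {N : ℕ}
    (h : ∀ b, 0 < b → b ≤ N → b ≠ 2 → p b) : genHead j p N = gen j N := by
  rw [← genHead_true]
  induction N with
  | zero => simp only [genHead_zero]
  | succ N ih =>
    rw [genHead_succ, genHead_succ, ih fun b h₁ h₂ => h b h₁ (by omega)]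
    have := h (N + 1) (by omega) le_rfl
    congr 2
    simpa using this

theorem gen_zero (j : ℕ) : gen j 0 = 1 := by
  rw [← genHead_true, genHead_zero]

theorem gen_succ (j N : ℕ) (h : N + 1 ≠ 2) : gen j (N + 1) = gen j N +
    X ^ (N + 1 + 2 * j * (2 - (N + 1) % 2)) * genHead j (Gap (N + 1)) N := by
  rw [← genHead_true, genHead_succ, if_pos ⟨trivial, h⟩, genHead_true]

theorem gen_two (j : ℕ) : gen j 2 = gen j 1 := by
  rw [← genHead_true, genHead_succ, if_neg (by simp), genHead_true, add_zero]

theorem gen_succ_of_gap (j : ℕ) {a N M : ℕ} (ha : a = N + 1) (hMN : M ≤ N) (h2 : a ≠ 2)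
    (h : ∀ b, 0 < b → b ≤ N → b ≠ 2 → (Gap a b ↔ b ≤ M)) (h2M : 2 ≤ M ∨ ¬ Gap a 2) :
    gen j a = gen j N + X ^ (a + 2 * j * (2 - a % 2)) * gen j M := by
  subst ha
  rw [gen_succ j N h2, genHead_eq_of_false hMN, genHead_eq_gen]
  · exact fun b h₁ h₂ h₃ => (h b h₁ (by omega) h₃).2 h₂
  · intro b h₁ h₂ hb
    by_cases hb2 : b = 2
    · subst hb2
      rcases h2M with h' | h'
      · omega
      · exact h' hb
    · exact absurd ((h b (by omega) h₂ hb2).1 hb) (by omega)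

theorem X_pow_size_of_odd (j a : ℕ) (h : a % 2 = 1) :
    (X : ℤ[X]) ^ (a + 2 * j * (2 - a % 2)) = X ^ (2 * j) * X ^ a := by
  rw [h, ← pow_add]
  congr 1
  omega

theorem X_pow_size_of_even (j a : ℕ) (h : a % 2 = 0) :
    (X : ℤ[X]) ^ (a + 2 * j * (2 - a % 2)) = (X ^ (2 * j)) ^ 2 * X ^ a := by
  rw [h, ← pow_mul, ← pow_add]
  congr 1
  omega

/-- The recurrences satisfied by the generating functions of Siladić partitions with bounded
largest part, over one period modulo `8`. -/
structure IsRec {R : Type*} [CommRing R] (g : ℕ → R) (t q : R) (n : ℕ) : Prop where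
  six : g (8 * n + 6) = g (8 * n + 5) + t * q * (g (8 * n + 5) - g (8 * n + 4))
  seven : g (8 * n + 7) = g (8 * n + 6) + t * q ^ (8 * n + 7) * g (8 * n + 1)
  eight : g (8 * n + 8) = g (8 * n + 7) + t ^ 2 * q ^ (8 * n + 8) * g (8 * n + 1)
  nine : g (8 * n + 9) = g (8 * n + 8) + t * q ^ (8 * n + 9) * g (8 * n + 4)
  ten : g (8 * n + 10) = g (8 * n + 9) + t ^ 2 * q ^ (8 * n + 10) * g (8 * n + 1)
  eleven : g (8 * n + 11) = g (8 * n + 10) + t * q ^ (8 * n + 11) * g (8 * n + 5)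
  twelve : g (8 * n + 12) = g (8 * n + 11) + t ^ 2 * q ^ (8 * n + 12) *
    (g (8 * n + 5) + t * q ^ (8 * n + 7) * g (8 * n + 1))
  thirteen : g (8 * n + 13) = g (8 * n + 12) + t * q ^ (8 * n + 13) *
    (g (8 * n + 5) + t * q ^ (8 * n + 7) * g (8 * n + 1))

theorem genHead_gap (j n a N : ℕ) (ha : a = N + 1) (h₁ : 8 * n + 12 ≤ a) (h₂ : a ≤ 8 * n + 14) :
    genHead j (Gap a) N =
      gen j (8 * n + 5) + X ^ (2 * j) * X ^ (8 * n + 7) * gen j (8 * n + 1) := by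
  subst ha
  rw [genHead_eq_of_false (M := 8 * n + 6 + 1) (by omega) (by unfold Gap; omega), genHead_succ,
    if_pos (by unfold Gap; omega), X_pow_size_of_odd _ _ (by omega),
    genHead_eq_of_false (M := 8 * n + 5) (by omega) (by unfold Gap; omega),
    genHead_eq_gen (by unfold Gap; omega),
    genHead_eq_of_false (M := 8 * n + 1) (by omega) (by unfold Gap; omega),
    genHead_eq_gen (by unfold Gap; omega)]

theorem gen_one (j : ℕ) : gen j 1 = 1 + X ^ (2 * j) * X := by
  rw [gen_succ j 0 (by omega), gen_zero, genHead_zero, X_pow_size_of_odd _ _ (by omega)]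
  ring

theorem gen_succ_of_lt_seven (j : ℕ) {a N : ℕ} (ha : a = N + 1) (h2 : a ≠ 2) (h : a < 7) :
    gen j a = gen j N + X ^ (a + 2 * j * (2 - a % 2)) := by
  rw [gen_succ_of_gap j (M := 0) ha (by omega) h2 (by unfold Gap; omega) (by unfold Gap; omega),
    gen_zero, mul_one]

theorem gen_four (j : ℕ) :
    gen j 4 = 1 + X ^ (2 * j) * X + X ^ (2 * j) * X ^ 3 + (X ^ (2 * j)) ^ 2 * X ^ 4 := by
  rw [gen_succ_of_lt_seven j (N := 3) rfl (by omega) (by omega),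
    gen_succ_of_lt_seven j (N := 2) rfl (by omega) (by omega), gen_two, gen_one,
    X_pow_size_of_odd j 3 (by omega), X_pow_size_of_even j 4 (by omega)]

theorem gen_five (j : ℕ) : gen j 5 = gen j 4 + X ^ (2 * j) * X ^ 5 := by
  rw [gen_succ_of_lt_seven j (N := 4) rfl (by omega) (by omega),
    X_pow_size_of_odd j 5 (by omega)]

theorem gen_six (j : ℕ) : gen j 6 = gen j 5 + (X ^ (2 * j)) ^ 2 * X ^ 6 := by
  rw [gen_succ_of_lt_seven j (N := 5) rfl (by omega) (by omega),
    X_pow_size_of_even j 6 (by omega)]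

theorem isRec_gen (j n : ℕ) : IsRec (gen j) (X ^ (2 * j)) X n where
  six := by
    rcases n with _ | n
    · simp only [mul_zero, zero_add]
      rw [gen_six, gen_five]
      ring
    · rw [show 8 * (n + 1) + 6 = 8 * n + 13 + 1 by ring, gen_succ _ _ (by omega),
        genHead_gap j n _ _ rfl (by omega) (by omega),
        show 8 * (n + 1) + 5 = 8 * n + 12 + 1 by ring, gen_succ _ _ (by omega),
        genHead_gap j n _ _ rfl (by omega) (by omega),
        show 8 * (n + 1) + 4 = 8 * n + 12 by ring,
        X_pow_size_of_odd _ _ (by omega), X_pow_size_of_even _ _ (by omega)]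
      ring
  seven := by
    rw [gen_succ_of_gap j (M := 8 * n + 1) rfl (by omega) (by omega) (by unfold Gap; omega)
      (by unfold Gap; omega), X_pow_size_of_odd _ _ (by omega)]
  eight := by
    rw [gen_succ_of_gap j (M := 8 * n + 1) rfl (by omega) (by omega) (by unfold Gap; omega)
      (by unfold Gap; omega), X_pow_size_of_even _ _ (by omega)]
  nine := by
    rw [gen_succ_of_gap j (M := 8 * n + 4) rfl (by omega) (by omega) (by unfold Gap; omega)
      (by unfold Gap; omega), X_pow_size_of_odd _ _ (by omega)]
  ten := by
    rw [gen_succ_of_gap j (M := 8 * n + 1) rfl (by omega) (by omega) (by unfold Gap; omega)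
      (by unfold Gap; omega), X_pow_size_of_even _ _ (by omega)]
  eleven := by
    rw [gen_succ_of_gap j (M := 8 * n + 5) rfl (by omega) (by omega) (by unfold Gap; omega)
      (by unfold Gap; omega), X_pow_size_of_odd _ _ (by omega)]
  twelve := by
    rw [gen_succ _ _ (by omega), genHead_gap j n _ _ rfl (by omega) (by omega),
      X_pow_size_of_even _ _ (by omega)]
  thirteen := by
    rw [gen_succ _ _ (by omega), genHead_gap j n _ _ rfl (by omega) (by omega),
      X_pow_size_of_odd _ _ (by omega)]

theorem IsRec.const_mul {R : Type*} [CommRing R] {g : ℕ → R} {t q : R} {n : ℕ}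
    (h : IsRec g t q n) (c : R) : IsRec (fun N => c * g N) t q n where
  six := by linear_combination c * h.six
  seven := by linear_combination c * h.seven
  eight := by linear_combination c * h.eight
  nine := by linear_combination c * h.nine
  ten := by linear_combination c * h.ten
  eleven := by linear_combination c * h.eleven
  twelve := by linear_combination c * h.twelve
  thirteen := by linear_combination c * h.thirteen

/-- The relations between two solutions of the recurrences, for `t` and `t * q ^ 2`, that are
propagated from one period to the next. -/
structure IsShift {R : Type*} [CommRing R] (g g' : ℕ → R) (t q : R) (n : ℕ) : Prop where
  one : g' (8 * n + 1) = g (8 * n + 4)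
  four : g' (8 * n + 4) = g (8 * n + 6) + t ^ 2 * q ^ (8 * n + 8) * g (8 * n + 1)
  five : g' (8 * n + 5) = g (8 * n + 8)

theorem IsShift.succ {R : Type*} [CommRing R] {g g' : ℕ → R} {t q : R} {n : ℕ}
    (h : IsShift g g' t q n) (hg : ∀ n, IsRec g t q n) (hg' : ∀ n, IsRec g' (t * q ^ 2) q n) :
    IsShift g g' t q (n + 1) := by
  have k := hg n
  have k' := hg' n
  have e := hg (n + 1)
  have e₆ := e.six
  have e₇ := e.seven
  have e₈ := e.eight
  simp only [show 8 * (n + 1) + 1 = 8 * n + 9 by ring, show 8 * (n + 1) + 4 = 8 * n + 12 by ring,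
    show 8 * (n + 1) + 5 = 8 * n + 13 by ring] at e₆ e₇ e₈
  constructor <;>
  simp only [show 8 * (n + 1) + 1 = 8 * n + 9 by ring,
    show 8 * (n + 1) + 4 = 8 * n + 12 by ring, show 8 * (n + 1) + 5 = 8 * n + 13 by ring] <;>
  simp only [e₈, e₇, e₆, k'.thirteen, k'.twelve, k'.eleven, k'.ten, k'.nine, k'.eight, k'.seven,
    k'.six, h.one, h.four, h.five, k.thirteen, k.twelve, k.eleven, k.ten, k.nine, k.eight,
    k.seven, k.six] <;>
  ring

theorem isShift_gen (j n : ℕ) :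
    IsShift (gen j) (fun N => (1 + X ^ (2 * j + 1)) * gen (j + 1) N) (X ^ (2 * j)) X n := by
  have hX : (X : ℤ[X]) ^ (2 * (j + 1)) = X ^ (2 * j) * X ^ 2 := by ring
  induction n with
  | zero =>
    have k := isRec_gen j 0
    have e₇ := k.seven
    have e₈ := k.eight
    simp only [mul_zero, zero_add] at e₇ e₈
    constructor <;>
    simp only [mul_zero, zero_add, e₈, e₇, gen_six, gen_five, gen_four, gen_one, hX] <;>
    ring
  | succ n ih =>
    refine ih.succ (isRec_gen j) fun n => ?_
    rw [← hX]
    exact (isRec_gen (j + 1) n).const_mul _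

theorem lists_mono {M N : ℕ} (h : M ≤ N) : lists M ⊆ lists N := fun l hl => by
  rw [mem_lists] at hl ⊢
  exact ⟨hl.1, hl.2.1, fun x hx => (hl.2.2 x hx).trans h⟩

theorem X_pow_dvd_gen_sub_gen {j m M N : ℕ} (hM : m ≤ M) (hN : m ≤ N) :
    (X : ℤ[X]) ^ (m + 1) ∣ gen j N - gen j M := by
  have key : ∀ N, m ≤ N → (X : ℤ[X]) ^ (m + 1) ∣ gen j N - gen j m := fun N hN => by
    rw [gen, gen, ← Finset.sum_sdiff (lists_mono hN), add_sub_cancel_right]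
    refine Finset.dvd_sum fun l hl => pow_dvd_pow _ ?_
    rw [Finset.mem_sdiff, mem_lists, mem_lists] at hl
    have : ∃ x ∈ l, m < x := by
      by_contra! h
      exact hl.2 ⟨hl.1.1, hl.1.2.1, h⟩
    obtain ⟨x, hx, hmx⟩ := this
    have := le_size (j := j) hx
    omega
  simpa using dvd_sub (key N hN) (key M hM)

theorem X_pow_dvd_gen_sub_one {j m N : ℕ} (hj : m ≤ 2 * j) :
    (X : ℤ[X]) ^ (m + 1) ∣ gen j N - 1 := by
  have hnil : {[]} ⊆ lists N := by simp [mem_lists]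
  rw [gen, ← Finset.sum_sdiff hnil, Finset.sum_singleton, size_nil, pow_zero,
    add_sub_cancel_right]
  refine Finset.dvd_sum fun l hl => pow_dvd_pow _ ?_
  rw [Finset.mem_sdiff, mem_lists] at hl
  rcases l with _ | ⟨a, l⟩
  · simp at hl
  · have := le_size (j := j) (l := a :: l) List.mem_cons_self
    have := hl.1.2.1 a List.mem_cons_self
    omega

theorem X_pow_dvd_gen_sub_mul_gen (j : ℕ) {m N : ℕ} (hN : m ≤ N) :
    (X : ℤ[X]) ^ (m + 1) ∣ gen j N - (1 + X ^ (2 * j + 1)) * gen (j + 1) N := by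
  have h₁ : (X : ℤ[X]) ^ (m + 1) ∣ gen j N - gen j (8 * N + 8) :=
    X_pow_dvd_gen_sub_gen (by omega) hN
  have h₂ : (X : ℤ[X]) ^ (m + 1) ∣ gen (j + 1) (8 * N + 5) - gen (j + 1) N :=
    X_pow_dvd_gen_sub_gen hN (by omega)
  rw [← (isShift_gen j N).five] at h₁
  convert dvd_add h₁ (h₂.mul_left (1 + X ^ (2 * j + 1))) using 1
  ring

theorem X_pow_dvd_gen_sub_prod {m N : ℕ} (hN : m ≤ N) (K : ℕ) : (X : ℤ[X]) ^ (m + 1) ∣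
    gen 0 N - (∏ i ∈ Finset.range K, (1 + X ^ (2 * i + 1))) * gen K N := by
  induction K with
  | zero => simp
  | succ K ih =>
    convert dvd_add ih ((X_pow_dvd_gen_sub_mul_gen K hN).mul_left
      (∏ i ∈ Finset.range K, (1 + X ^ (2 * i + 1)))) using 1
    rw [Finset.prod_range_succ]
    ring

theorem coeff_gen_zero (n : ℕ) :
    (gen 0 n).coeff n = (∏ i ∈ Finset.range n, (1 + (X : ℤ[X]) ^ (2 * i + 1))).coeff n := by
  have h := dvd_add (X_pow_dvd_gen_sub_prod le_rfl n)
    ((X_pow_dvd_gen_sub_one (j := n) (m := n) (N := n) (by omega)).mul_left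
      (∏ i ∈ Finset.range n, (1 + X ^ (2 * i + 1))))
  have h' := X_pow_dvd_iff.1 h n n.lt_succ_self
  rw [← sub_eq_zero, ← coeff_sub, ← h']
  congr 1
  ring

/-- The strictly decreasing lists of odd numbers less than `2 * K`. -/
def oddLists : ℕ → Finset (List ℕ)
  | 0 => {[]}
  | K + 1 => oddLists K ∪ (oddLists K).image (List.cons (2 * K + 1))

theorem mem_oddLists {K : ℕ} {l : List ℕ} :
    l ∈ oddLists K ↔ l.IsChain (· > ·) ∧ (∀ x ∈ l, Odd x) ∧ ∀ x ∈ l, x < 2 * K := by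
  induction K generalizing l with
  | zero =>
    rcases l with _ | ⟨a, l⟩
    · simp [oddLists]
    · simp only [oddLists, Finset.mem_singleton, reduceCtorEq, List.mem_cons, forall_eq_or_imp,
        false_iff]
      omega
  | succ K ih =>
    rw [oddLists, Finset.mem_union, ih]
    constructor
    · rintro (⟨h₁, h₂, h₃⟩ | h)
      · exact ⟨h₁, h₂, fun x hx => (h₃ x hx).trans (by omega)⟩
      · simp only [Finset.mem_image, ih] at h
        obtain ⟨l, ⟨h₁, h₂, h₃⟩, rfl⟩ := h
        refine ⟨List.isChain_cons.2 ⟨fun y hy => ?_, h₁⟩, ?_, ?_⟩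
        · have := h₃ y (List.mem_of_mem_head? hy)
          omega
        all_goals simp only [List.mem_cons, forall_eq_or_imp]
        · exact ⟨odd_two_mul_add_one K, h₂⟩
        · exact ⟨by omega, fun x hx => (h₃ x hx).trans (by omega)⟩
    · rintro ⟨h₁, h₂, h₃⟩
      rcases l with _ | ⟨a, l⟩
      · simp
      have hlt := lt_of_isChain_cons (fun _ _ h => h) h₁
      have haK := h₃ a (by simp)
      obtain ⟨i, hi⟩ := h₂ a (by simp)
      rcases Nat.lt_or_ge a (2 * K) with ha | ha
      · refine Or.inl ⟨h₁, h₂, ?_⟩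
        simp only [List.mem_cons, forall_eq_or_imp]
        exact ⟨ha, fun x hx => (hlt x hx).trans ha⟩
      · obtain rfl : a = 2 * K + 1 := by omega
        right
        rw [List.isChain_cons] at h₁
        refine Finset.mem_image_of_mem _ (ih.2 ⟨h₁.2, fun x hx => h₂ x (by simp [hx]), ?_⟩)
        intro x hx
        have := hlt x hx
        obtain ⟨k, hk⟩ := h₂ x (by simp [hx])
        omega

theorem sum_oddLists (K : ℕ) : ∑ l ∈ oddLists K, (X : ℤ[X]) ^ l.sum =
    ∏ i ∈ Finset.range K, (1 + X ^ (2 * i + 1)) := by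
  induction K with
  | zero => simp [oddLists]
  | succ K ih =>
    rw [oddLists, Finset.sum_union, Finset.sum_image (fun _ _ _ _ h => (List.cons.inj h).2),
      Finset.prod_range_succ, ← ih]
    · simp only [List.sum_cons, pow_add, ← Finset.mul_sum]
      ring
    · rw [Finset.disjoint_left]
      intro l hl hl'
      simp only [mem_oddLists, Finset.mem_image] at hl hl'
      obtain ⟨l, -, rfl⟩ := hl'
      have := hl.2.2 (2 * K + 1) (by simp)
      omega

theorem coeff_sum_X_pow {α : Type*} (s : Finset α) (f : α → ℕ) (n : ℕ) :
    (∑ a ∈ s, (X : ℤ[X]) ^ f a).coeff n = (s.filter fun a => f a = n).card := by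
  simp only [finsetSum_coeff, coeff_X_pow, eq_comm (a := n), Finset.sum_boole]

theorem card_filter_oddLists (n : ℕ) : ((oddLists n).filter fun l => l.sum = n).card =
    ((lists n).filter fun l => l.sum = n).card := by
  have h := coeff_gen_zero n
  rw [← sum_oddLists, gen] at h
  simp only [size_zero, coeff_sum_X_pow] at h
  exact_mod_cast h.symm

end Siladic

/-- Siladić's theorem: partitions into distinct odd parts are equinumerous with
partitions with parts ≠ 2, gaps ≥ 5 and congruence conditions on small gaps. -/
theorem siladic (n : ℕ) :
    Nat.card {l : List ℕ // l.Chain' (· > ·) ∧ (∀ x ∈ l, Odd x) ∧ l.sum = n} =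
    Nat.card {l : List ℕ //
      l.Chain' (· ≥ ·) ∧ (∀ x ∈ l, 0 < x ∧ x ≠ 2) ∧ l.sum = n ∧
      l.Chain' (fun a b =>
        a - b ≥ 5 ∧
        (a - b = 5 → a % 8 = 1 ∨ a % 8 = 4) ∧
        (a - b = 6 → a % 8 = 1 ∨ a % 8 = 3 ∨ a % 8 = 5 ∨ a % 8 = 7) ∧
        (a - b = 7 → a % 8 = 0 ∨ a % 8 = 1 ∨ a % 8 = 3 ∨ a % 8 = 4 ∨ a % 8 = 6 ∨ a % 8 = 7) ∧
        (a - b = 8 → a % 8 = 0 ∨ a % 8 = 1 ∨ a % 8 = 3 ∨ a % 8 = 4 ∨ a % 8 = 5 ∨ a % 8 = 7))} := by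
  rw [Nat.subtype_card ((Siladic.oddLists n).filter fun l => l.sum = n),
    Nat.subtype_card ((Siladic.lists n).filter fun l => l.sum = n),
    Siladic.card_filter_oddLists]
  · intro l
    rw [Finset.mem_filter, Siladic.mem_lists]
    constructor
    · rintro ⟨⟨h₁, h₂, -⟩, h₃⟩
      exact ⟨h₁.imp fun a b h => h.lt.le, h₂, h₃, h₁⟩
    · rintro ⟨-, h₂, h₃, h₁⟩
      exact ⟨⟨h₁, h₂, fun x hx => h₃ ▸ List.single_le_sum (by simp) _ hx⟩, h₃⟩
  · intro l
    rw [Finset.mem_filter, Siladic.mem_oddLists]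
    constructor
    · rintro ⟨⟨h₁, h₂, -⟩, h₃⟩
      exact ⟨h₁, h₂, h₃⟩
    · rintro ⟨h₁, h₂, h₃⟩
      refine ⟨⟨h₁, h₂, fun x hx => ?_⟩, h₃⟩
      have h₄ : x ≤ n := h₃ ▸ List.single_le_sum (by simp) _ hx
      have := (h₂ x hx).pos
      omega
end

section
/- (Dousse's refinement of Siladić's theorem, the case m = 2.) For all non-negative integers u, v, n, the cardinality of D(u,v,n) equals the cardinality of C(u,v,n), where D(u,v,n) is the set of finite sequences λ_1 ≫_c λ_2 ≫_c ⋯ ≫_c λ_s of parts in O' ∪ E' (for the two colors a_1 = a < a_2 = b) whose sizes sum to n, with u equal to the number of primary parts of color a plus the number of secondary parts (k,p,q) with p = a plus the number of secondary parts (k,p,q) with q = a (so parts of color a² are counted twice), and v defined symmetrically with b in place of a; and C(u,v,n) is the set of pairs (A,B) of finite sets of positive integers with |A| = u, |B| = v, and (sum of A) + (sum of B) = n. -/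
/-- δ(p,q) = 1 if p ≤ q and 0 otherwise. -/
def delta {m : ℕ} (p q : Fin m) : ℤ := if p ≤ q then 1 else 0

/-- Colored parts: a primary part (k,p) of size k, or a secondary part (k,p,q)
of size 2k + δ(p,q). -/
inductive CPart (m : ℕ) : Type where
  | primary (k : ℤ) (p : Fin m) : CPart m
  | secondary (k : ℤ) (p q : Fin m) : CPart m

/-- The size of a colored part. -/
def CPart.size {m : ℕ} : CPart m → ℤ
  | .primary k _ => k
  | .secondary k p q => 2 * k + delta p q

/-- The relation ≫_c between colored parts. -/
def gg {m : ℕ} : CPart m → CPart m → Prop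
  | .primary k p, .primary l q => k - l ≥ 1 + delta p q
  | .primary k p, .secondary l q r => k - (2 * l + delta q r) ≥ delta p q + delta q r
  | .secondary k p q, .primary l r => (2 * k + delta p q) - l ≥ 1 + delta p q + delta q r
  | .secondary k p q, .secondary l r s =>
      (2 * k + delta p q) - (2 * l + delta r s) ≥ delta p q + 2 * delta q r + delta r s

/-- Membership in O' ∪ E' : the integer entry is at least 1. -/
def CPart.mem' {m : ℕ} : CPart m → Prop
  | .primary k _ => 1 ≤ k
  | .secondary k _ _ => 1 ≤ k

/-- The number of times the color `x` is used by a part: secondary parts use two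
colors (so a part of color x² counts twice). -/
def colorCount {m : ℕ} (x : Fin m) : CPart m → ℕ
  | .primary _ p => if p = x then 1 else 0
  | .secondary _ p q => (if p = x then 1 else 0) + (if q = x then 1 else 0)

section Recurrence

variable {R : Type*} [CommRing R]

/-- The step of the recurrence for the generating functions of admissible sequences whose first
part has size at most `2k - 2`, lies before `(2k - 1, b)`, or has size at most `2k - 1`;
here `Q = q ^ (2k)`. -/
def gfStep (a b q Q : R) (s : R × R × R) : R × R × R :=
  let x := s.2.2 + a * b * Q * s.1
  let z := x + a * Q * s.1
  let e := z + b * Q * s.2.1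
  let y := e + a * (Q * q) * x + a * a * (Q * q) * s.1 + a * b * (Q * q) * s.2.1
  (e, y, y + b * (Q * q) * z + b * b * (Q * q) * s.2.1)

/-- The triple of generating functions related by `gfStep`, starting with `k = 1`. -/
def gfState (a b q : R) : ℕ → R × R × R
  | 0 => (1, 1 + a * q, 1 + a * q + b * q)
  | i + 1 => gfStep a b q (q ^ (2 * i + 2)) (gfState a b q i)

theorem gfState_shift (a b q : R) (i : ℕ) :
    (gfState a b q i).2.1 = (1 + a * q) * (gfState b (a * q) q i).1 ∧
    (gfState a b q i).2.2 + a * b * q ^ (2 * i + 2) * (gfState a b q i).1 =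
      (1 + a * q) * (gfState b (a * q) q i).2.1 ∧
    (1 + a * q) * (gfState b (a * q) q i).2.2 =
      (gfState a b q i).2.2 + a * b * q ^ (2 * i + 2) * (gfState a b q i).1 +
        a * q ^ (2 * i + 2) * (1 + a * q) * (gfState a b q i).1 := by
  induction i with
  | zero => simp only [gfState]; refine ⟨by ring, by ring, by ring⟩
  | succ i ih =>
    have hQ : q ^ (2 * (i + 1) + 2) = q ^ (2 * i + 2) * q * q := by ring
    simp only [gfState, gfStep, hQ]
    generalize q ^ (2 * i + 2) = Q at *
    generalize gfState a b q i = s at *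
    generalize gfState b (a * q) q i = t at *
    obtain ⟨e, y, o⟩ := s
    obtain ⟨e', y', o'⟩ := t
    simp only at *
    obtain ⟨h1, h2, h3⟩ := ih
    have H1 : (o + a * b * Q * e + a * Q * e + b * Q * y) + a * (Q * q) * (o + a * b * Q * e)
        + a * a * (Q * q) * e + a * b * (Q * q) * y
        = (1 + a * q) * (o' + b * (a * q) * Q * e' + b * Q * e' + a * q * Q * y') := by
      linear_combination (b * a * q * Q + b * Q) * h1 + a * q * Q * h2 - h3
    have H2 : (o + a * b * Q * e + a * Q * e + b * Q * y) + a * (Q * q) * (o + a * b * Q * e)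
        + a * a * (Q * q) * e + a * b * (Q * q) * y
        + b * (Q * q) * (o + a * b * Q * e + a * Q * e) + b * b * (Q * q) * y
        + a * b * (Q * q * q) * (o + a * b * Q * e + a * Q * e + b * Q * y)
        = (1 + a * q) * (o' + b * (a * q) * Q * e' + b * Q * e' + a * q * Q * y'
          + b * (Q * q) * (o' + b * (a * q) * Q * e') + b * b * (Q * q) * e'
          + b * (a * q) * (Q * q) * y') := by
      linear_combination H1 + (b * (Q * q) * (b * a * q * Q) + b * b * (Q * q)) * h1
        + b * (a * q) * (Q * q) * h2 - b * (Q * q) * h3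
    refine ⟨H1, H2, ?_⟩
    linear_combination -H2 - (a * q) * (Q * q) * (b * a * q * Q + b * Q) * h1
      - (a * q) * (a * q) * (Q * q) * h2 + (a * q) * (Q * q) * h3

theorem gfState_zero (q : R) (i : ℕ) : gfState 0 0 q i = (1, 1, 1) := by
  induction i with
  | zero => simp [gfState]
  | succ i ih => simp [gfState, gfStep, ih]

theorem gfState_functional_equation {q : R} {M : ℕ} (hq : q ^ M = 0) (a b : R) :
    (gfState a b q (M + 1)).1 = (1 + a * q) * (gfState b (a * q) q (M + 1)).1 := by
  rw [← (gfState_shift a b q (M + 1)).1]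
  have hQ : q ^ (2 * M + 2) = 0 := pow_eq_zero_of_le (by omega) hq
  simp [gfState, gfStep, hQ]

theorem gfState_eq_prod_mul {q : R} {M : ℕ} (hq : q ^ M = 0) (a b : R) (N : ℕ) :
    (gfState a b q (M + 1)).1 =
      (∏ j ∈ Finset.Ioc 0 N, (1 + a * q ^ j)) * (∏ j ∈ Finset.Ioc 0 N, (1 + b * q ^ j)) *
        (gfState (a * q ^ N) (b * q ^ N) q (M + 1)).1 := by
  induction N with
  | zero => simp
  | succ N ih =>
    rw [ih, gfState_functional_equation hq, gfState_functional_equation hq,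
      Finset.prod_Ioc_succ_top (Nat.zero_le N), Finset.prod_Ioc_succ_top (Nat.zero_le N)]
    simp only [pow_succ, mul_assoc]
    ring

theorem gfState_eq_prod {q : R} {M : ℕ} (hq : q ^ M = 0) (a b : R) :
    (gfState a b q (M + 1)).1 =
      (∏ j ∈ Finset.Ioc 0 M, (1 + a * q ^ j)) * ∏ j ∈ Finset.Ioc 0 M, (1 + b * q ^ j) := by
  rw [gfState_eq_prod_mul hq a b M, hq, mul_zero, mul_zero, gfState_zero, mul_one]

end Recurrence

section Sequences

variable {R : Type*} [CommRing R]

/-- The weight of a part. -/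
def CPart.weight (a b q : R) (x : CPart 2) : R :=
  a ^ colorCount 0 x * b ^ colorCount 1 x * q ^ x.size.toNat

/-- Admissible sequences whose first part, if any, satisfies `T`. -/
def Admissible (T : CPart 2 → Prop) (l : List (CPart 2)) : Prop :=
  l.IsChain gg ∧ (∀ x ∈ l, x.mem') ∧ ∀ x ∈ l.head?, T x

/-- There are finitely many admissible sequences with first part in `T`, and their
generating function is `p`. -/
def HasGF (a b q : R) (T : CPart 2 → Prop) (p : R) : Prop :=
  ∃ S : Finset (List (CPart 2)), (∀ l, l ∈ S ↔ Admissible T l) ∧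
    ∑ l ∈ S, (l.map (CPart.weight a b q)).prod = p

theorem admissible_cons {T : CPart 2 → Prop} {x : CPart 2} {l : List (CPart 2)} :
    Admissible T (x :: l) ↔ T x ∧ x.mem' ∧ Admissible (gg x) l := by
  simp only [Admissible, List.isChain_cons, List.mem_cons, forall_eq_or_imp, List.head?_cons,
    Option.mem_some_iff, forall_eq']
  tauto

theorem Admissible.congr {T T' : CPart 2 → Prop} (h : ∀ y, y.mem' → (T y ↔ T' y))
    (l : List (CPart 2)) : Admissible T l ↔ Admissible T' l := by
  cases l with
  | nil => simp [Admissible]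
  | cons x l =>
    simp only [admissible_cons]
    have := h x
    tauto

theorem HasGF.of_empty (a b q : R) {T : CPart 2 → Prop} (h : ∀ y, y.mem' → ¬ T y) :
    HasGF a b q T 1 := by
  refine ⟨{[]}, fun l => ?_, by simp⟩
  cases l with
  | nil => simp [Admissible]
  | cons x l =>
    have := h x
    simp only [Finset.mem_singleton, reduceCtorEq, admissible_cons]
    tauto

theorem HasGF.insert {a b q : R} {T T' T₂ : CPart 2 → Prop} {p p' : R} (x : CPart 2)
    (hT : HasGF a b q T p) (hT' : HasGF a b q T' p') (hx : x.mem') (hxT : ¬ T x)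
    (h₂ : ∀ y, y.mem' → (T₂ y ↔ T y ∨ y = x)) (h' : ∀ y, y.mem' → (gg x y ↔ T' y)) :
    HasGF a b q T₂ (p + x.weight a b q * p') := by
  classical
  obtain ⟨S, hS, rfl⟩ := hT
  obtain ⟨S', hS', rfl⟩ := hT'
  refine ⟨S ∪ S'.image (List.cons x), fun l => ?_, ?_⟩
  · cases l with
    | nil => simp [hS, Admissible]
    | cons z l =>
      simp only [Finset.mem_union, Finset.mem_image, List.cons.injEq, hS, hS', admissible_cons]
      have := h₂ z
      constructor
      · rintro (h | ⟨l', h, rfl, rfl⟩)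
        · tauto
        · exact ⟨(h₂ _ hx).2 (Or.inr rfl), hx, (Admissible.congr h' _).2 h⟩
      · rintro ⟨h1, h2, h3⟩
        rcases (this h2).1 h1 with h | rfl
        · exact Or.inl ⟨h, h2, h3⟩
        · exact Or.inr ⟨l, (Admissible.congr h' _).1 h3, rfl, rfl⟩
  · rw [Finset.sum_union, Finset.sum_image (by simp), Finset.mul_sum]
    · simp
    · rw [Finset.disjoint_left]
      intro l hl hl'
      obtain ⟨l', -, rfl⟩ := Finset.mem_image.1 hl'
      exact hxT (admissible_cons.1 ((hS _).1 hl)).1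

theorem CPart.forall_fin_two {P : CPart 2 → Prop} : (∀ y, P y) ↔
    ∀ k, P (.primary k 0) ∧ P (.primary k 1) ∧ P (.secondary k 0 0) ∧ P (.secondary k 0 1) ∧
      P (.secondary k 1 0) ∧ P (.secondary k 1 1) := by
  refine ⟨fun h k => by simp [h], fun h y => ?_⟩
  rcases y with ⟨k, p⟩ | ⟨k, p, r⟩ <;> have := h k <;> fin_cases p <;> try fin_cases r
  all_goals simp_all

/-- The three components of `gfState` count the admissible sequences whose first part has size
at most `2i`, size at most `2i + 1` except for the colors `b` and `b²` in size `2i + 1`, and size at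
most `2i + 1`. -/
theorem hasGF_gfState (a b q : R) (i : ℕ) :
    HasGF a b q (fun y => y.size ≤ 2 * i) (gfState a b q i).1 ∧
    HasGF a b q (fun y => y.size ≤ 2 * i + 1 ∧ y ≠ .primary (2 * i + 1) 1 ∧ y ≠ .secondary i 1 1)
      (gfState a b q i).2.1 ∧
    HasGF a b q (fun y => y.size ≤ 2 * i + 1) (gfState a b q i).2.2 := by
  induction i with
  | zero =>
    have h0 : HasGF a b q (fun y => y.size ≤ 2 * (0 : ℕ)) 1 := by
      apply HasGF.of_empty
      simp [CPart.forall_fin_two, CPart.mem', CPart.size, delta]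
      grind
    have h1 := HasGF.insert (.primary 1 0) h0 h0
      (T₂ := fun y => y.size ≤ 2 * (0 : ℕ) + 1 ∧ y ≠ .primary (2 * (0 : ℕ) + 1) 1 ∧
        y ≠ .secondary (0 : ℕ) 1 1)
      (by grind [CPart.mem']) (by grind [CPart.size, delta])
      (by simp [CPart.forall_fin_two, CPart.mem', CPart.size, delta]; grind)
      (by simp [CPart.forall_fin_two, CPart.mem', CPart.size, delta, gg]; grind)
    have h2 := HasGF.insert (.primary 1 1) h1 h0
      (T₂ := fun y => y.size ≤ 2 * (0 : ℕ) + 1)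
      (by grind [CPart.mem']) (by grind [CPart.size, delta])
      (by simp [CPart.forall_fin_two, CPart.mem', CPart.size, delta]; grind)
      (by simp [CPart.forall_fin_two, CPart.mem', CPart.size, delta, gg]; grind)
    refine ⟨h0, ?_, ?_⟩
    · convert h1 using 1
      simp [gfState, CPart.weight, colorCount, CPart.size]
    · convert h2 using 1
      simp [gfState, CPart.weight, colorCount, CPart.size]
  | succ i ih =>
    obtain ⟨he, hy, ho⟩ := ih
    have hx := HasGF.insert (.secondary (i + 1) 1 0) ho he
      (T₂ := fun y => y.size ≤ 2 * i + 1 ∨ y = .secondary (i + 1) 1 0)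
      (by grind [CPart.mem']) (by grind [CPart.size, delta])
      (by simp)
      (by simp [CPart.forall_fin_two, CPart.mem', CPart.size, delta, gg]; grind)
    have hz := HasGF.insert (.primary (2 * i + 2) 0) hx he
      (T₂ := fun y => y.size ≤ 2 * i + 1 ∨ y = .secondary (i + 1) 1 0 ∨
        y = .primary (2 * i + 2) 0)
      (by grind [CPart.mem']) (by grind [CPart.size, delta])
      (by simp [or_assoc])
      (by simp [CPart.forall_fin_two, CPart.mem', CPart.size, delta, gg]; grind)
    have he' := HasGF.insert (.primary (2 * i + 2) 1) hz hy
      (T₂ := fun y => y.size ≤ 2 * i + 2)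
      (by grind [CPart.mem']) (by grind [CPart.size, delta])
      (by simp [CPart.forall_fin_two, CPart.mem', CPart.size, delta]; grind)
      (by simp [CPart.forall_fin_two, CPart.mem', CPart.size, delta, gg]; grind)
    have hy1 := HasGF.insert (.primary (2 * i + 3) 0) he' hx
      (T₂ := fun y => y.size ≤ 2 * i + 2 ∨ y = .primary (2 * i + 3) 0)
      (by grind [CPart.mem']) (by grind [CPart.size, delta])
      (by simp)
      (by simp [CPart.forall_fin_two, CPart.mem', CPart.size, delta, gg]; grind)
    have hy2 := HasGF.insert (.secondary (i + 1) 0 0) hy1 he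
      (T₂ := fun y => y.size ≤ 2 * i + 2 ∨ y = .primary (2 * i + 3) 0 ∨
        y = .secondary (i + 1) 0 0)
      (by grind [CPart.mem']) (by grind [CPart.size, delta])
      (by simp [or_assoc])
      (by simp [CPart.forall_fin_two, CPart.mem', CPart.size, delta, gg]; grind)
    have hy' := HasGF.insert (.secondary (i + 1) 0 1) hy2 hy
      (T₂ := fun y => y.size ≤ 2 * i + 3 ∧ y ≠ .primary (2 * i + 3) 1 ∧
        y ≠ .secondary (i + 1) 1 1)
      (by grind [CPart.mem']) (by grind [CPart.size, delta])
      (by simp [CPart.forall_fin_two, CPart.mem', CPart.size, delta]; grind)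
      (by simp [CPart.forall_fin_two, CPart.mem', CPart.size, delta, gg]; grind)
    have ho1 := HasGF.insert (.primary (2 * i + 3) 1) hy' hz
      (T₂ := fun y => y.size ≤ 2 * i + 3 ∧ y ≠ .secondary (i + 1) 1 1)
      (by grind [CPart.mem']) (by grind [CPart.size, delta])
      (by simp [CPart.forall_fin_two, CPart.mem', CPart.size, delta]; grind)
      (by simp [CPart.forall_fin_two, CPart.mem', CPart.size, delta, gg]; grind)
    have ho' := HasGF.insert (.secondary (i + 1) 1 1) ho1 hy
      (T₂ := fun y => y.size ≤ 2 * i + 3)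
      (by grind [CPart.mem']) (by grind [CPart.size, delta])
      (by simp [CPart.forall_fin_two, CPart.mem', CPart.size, delta]; grind)
      (by simp [CPart.forall_fin_two, CPart.mem', CPart.size, delta, gg]; grind)
    have h2 : (2 * (i : ℤ) + 2).toNat = 2 * i + 2 := by omega
    have h2' : (2 * ((i : ℤ) + 1)).toNat = 2 * i + 2 := by omega
    have h3 : (2 * (i : ℤ) + 3).toNat = 2 * i + 3 := by omega
    have h3' : (2 * ((i : ℤ) + 1) + 1).toNat = 2 * i + 3 := by omega
    simp only [gfState, gfStep]
    refine ⟨?_, ?_, ?_⟩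
    · convert he' using 1
      · push_cast; ring_nf
      · simp [CPart.weight, colorCount, CPart.size, delta, h2, h2']
    · convert hy' using 1
      · push_cast; ring_nf
      · simp [CPart.weight, colorCount, CPart.size, delta, h2, h2', h3, h3']
        ring
    · convert ho' using 1
      · push_cast; ring_nf
      · simp [CPart.weight, colorCount, CPart.size, delta, h2, h2', h3, h3']
        ring


theorem CPart.size_pos {x : CPart 2} (hx : x.mem') : 0 < x.size := by
  rcases x with ⟨k, p⟩ | ⟨k, p, r⟩ <;> simp only [CPart.mem', CPart.size, delta] at * <;> grind

theorem CPart.size_le_sum {l : List (CPart 2)} (hl : ∀ x ∈ l, x.mem') {x : CPart 2} (hx : x ∈ l) :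
    x.size ≤ (l.map CPart.size).sum := by
  refine List.single_le_sum (fun y hy => ?_) _ (List.mem_map_of_mem hx)
  obtain ⟨z, hz, rfl⟩ := List.mem_map.1 hy
  exact (CPart.size_pos (hl z hz)).le

theorem prod_map_weight (a b q : R) {l : List (CPart 2)} (hl : ∀ x ∈ l, x.mem') :
    0 ≤ (l.map CPart.size).sum ∧ (l.map (CPart.weight a b q)).prod =
      a ^ (l.map (colorCount 0)).sum * b ^ (l.map (colorCount 1)).sum *
        q ^ (l.map CPart.size).sum.toNat := by
  induction l with
  | nil => simp
  | cons x l ih =>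
    obtain ⟨h0, h⟩ := ih fun y hy => hl y (List.mem_cons_of_mem x hy)
    have hx := CPart.size_pos (hl x List.mem_cons_self)
    refine ⟨by simp only [List.map_cons, List.sum_cons]; omega, ?_⟩
    simp only [List.map_cons, List.sum_cons, List.prod_cons, h, Int.toNat_add hx.le h0, pow_add,
      CPart.weight]
    ring

end Sequences

section Subsets

theorem prod_one_add_eq_sum {R : Type*} [CommRing R] (a q : R) (M : ℕ) :
    ∏ j ∈ Finset.Ioc 0 M, (1 + a * q ^ j) =
      ∑ A ∈ (Finset.Ioc 0 M).powerset, a ^ A.card * q ^ A.sum id := by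
  simp [Finset.prod_one_add, Finset.prod_mul_distrib, ← Finset.prod_pow_eq_pow_sum]

theorem pow_dvd_sum_sub_sum {ι κ : Type*} {P : Type} [CommRing P] (S : Finset ι) (T : Finset κ)
    (f₁ f₂ f₃ : ι → ℕ) (g₁ g₂ g₃ : κ → ℕ) (N : ℕ) (x y z : P)
    (h : ∀ (R : Type) [CommRing R] (a b q : R), q ^ N = 0 →
      ∑ i ∈ S, a ^ f₁ i * b ^ f₂ i * q ^ f₃ i = ∑ j ∈ T, a ^ g₁ j * b ^ g₂ j * q ^ g₃ j) :
    z ^ N ∣ ∑ i ∈ S, x ^ f₁ i * y ^ f₂ i * z ^ f₃ i -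
      ∑ j ∈ T, x ^ g₁ j * y ^ g₂ j * z ^ g₃ j := by
  let π := Ideal.Quotient.mk (Ideal.span {z ^ N})
  have hπ : π z ^ N = 0 := by
    rw [← map_pow, Ideal.Quotient.eq_zero_iff_mem]
    exact Ideal.mem_span_singleton_self _
  have key := h _ (π x) (π y) (π z) hπ
  simp only [← map_pow, ← map_mul, ← map_sum] at key
  rwa [Ideal.Quotient.eq, Ideal.mem_span_singleton] at key

open Polynomial in
/-- Finite families with the same trivariate generating function modulo `q ^ (n + 1)` have equally
many members of weight `(u, v, n)`. -/
theorem card_filter_eq_of_sum_eq {ι κ : Type*} (S : Finset ι) (T : Finset κ)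
    (f₁ f₂ f₃ : ι → ℕ) (g₁ g₂ g₃ : κ → ℕ) (u v n : ℕ)
    (h : ∀ (R : Type) [CommRing R] (a b q : R), q ^ (n + 1) = 0 →
      ∑ i ∈ S, a ^ f₁ i * b ^ f₂ i * q ^ f₃ i = ∑ j ∈ T, a ^ g₁ j * b ^ g₂ j * q ^ g₃ j) :
    (S.filter fun i => f₁ i = u ∧ f₂ i = v ∧ f₃ i = n).card =
      (T.filter fun j => g₁ j = u ∧ g₂ j = v ∧ g₃ j = n).card := by
  have key := pow_dvd_sum_sub_sum S T f₁ f₂ f₃ g₁ g₂ g₃ (n + 1) (C (C X)) (C X) (X : ℤ[X][X][X]) h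
  rw [X_pow_dvd_iff] at key
  have key' := congrArg (fun p : ℤ[X][X] => (p.coeff v).coeff u) (key n n.lt_succ_self)
  have hc : ∀ i j k : ℕ, (((C (C X) ^ i * C X ^ j * X ^ k : ℤ[X][X][X]).coeff n).coeff v).coeff u =
      if i = u ∧ j = v ∧ k = n then 1 else 0 := by
    intro i j k
    rw [← C_pow, ← C_pow, ← C_pow, ← C_mul, coeff_C_mul, coeff_X_pow]
    split_ifs with h1 h2 h2
    · rw [mul_one, coeff_C_mul, coeff_X_pow]
      simp [coeff_X_pow, h2]
    · rw [mul_one, coeff_C_mul, coeff_X_pow]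
      split_ifs with h3
      · rw [mul_one, coeff_X_pow, if_neg]
        tauto
      · simp
    · exact absurd h2.2.2.symm h1
    · simp
  simp only [coeff_sub, finsetSum_coeff, hc, coeff_zero, Finset.sum_boole, sub_eq_zero] at key'
  exact_mod_cast key'

end Subsets

/-- Dousse's refinement of Siladić's theorem, case m = 2 (colors a = 0 < b = 1). -/
theorem dousse_two_colors (u v n : ℕ) :
    Nat.card {l : List (CPart 2) //
      l.Chain' gg ∧ (∀ x ∈ l, x.mem') ∧
      (l.map CPart.size).sum = (n : ℤ) ∧
      (l.map (colorCount 0)).sum = u ∧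
      (l.map (colorCount 1)).sum = v} =
    Nat.card {AB : Finset ℕ × Finset ℕ //
      (∀ x ∈ AB.1, 0 < x) ∧ (∀ x ∈ AB.2, 0 < x) ∧
      AB.1.card = u ∧ AB.2.card = v ∧
      AB.1.sum id + AB.2.sum id = n} := by
  classical
  have hfin : HasGF (0 : ℤ) 0 0 (fun y => y.size ≤ 2 * (n + 2 : ℕ)) _ :=
    (hasGF_gfState 0 0 0 (n + 2)).1
  obtain ⟨S, hS, -⟩ := hfin
  let P := (Finset.Ioc 0 (n + 1)).powerset
  have key := card_filter_eq_of_sum_eq S (P ×ˢ P) (fun l => (l.map (colorCount 0)).sum)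
    (fun l => (l.map (colorCount 1)).sum) (fun l => (l.map CPart.size).sum.toNat)
    (fun AB => AB.1.card) (fun AB => AB.2.card) (fun AB => AB.1.sum id + AB.2.sum id) u v n ?_
  · rw [Nat.subtype_card _ ?_, Nat.subtype_card _ ?_]
    · exact key
    · rintro ⟨A, B⟩
      have hle : ∀ A : Finset ℕ, (∀ x ∈ A, 0 < x) → A.sum id ≤ n →
          A ⊆ Finset.Ioc 0 (n + 1) := fun A hA hn x hx => by
        have := Finset.single_le_sum (f := id) (fun _ _ => Nat.zero_le _) hx
        have := hA x hx
        simp only [id, Finset.mem_Ioc] at *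
        omega
      simp only [P, Finset.mem_filter, Finset.mem_product, Finset.mem_powerset]
      constructor
      · rintro ⟨⟨hA, hB⟩, h⟩
        exact ⟨fun x hx => (Finset.mem_Ioc.1 (hA hx)).1,
          fun x hx => (Finset.mem_Ioc.1 (hB hx)).1, h⟩
      · rintro ⟨hA, hB, h⟩
        exact ⟨⟨hle A hA (by omega), hle B hB (by omega)⟩, h⟩
    · intro l
      simp only [Finset.mem_filter, hS, Admissible]
      constructor
      · rintro ⟨⟨hc, hm, -⟩, hu, hv, hn⟩
        have := (prod_map_weight (0 : ℤ) 0 0 hm).1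
        exact ⟨hc, hm, by omega, hu, hv⟩
      · rintro ⟨hc, hm, hn, hu, hv⟩
        refine ⟨⟨hc, hm, fun x hx => ?_⟩, hu, hv, by omega⟩
        have := CPart.size_le_sum hm (List.mem_of_mem_head? hx)
        push_cast
        omega
  · intro R _ a b q hq
    obtain ⟨S', hS', hsum⟩ := (hasGF_gfState a b q (n + 2)).1
    obtain rfl : S' = S := by ext l; rw [hS, hS']
    rw [gfState_eq_prod hq, prod_one_add_eq_sum, prod_one_add_eq_sum, Finset.sum_mul_sum,
      ← Finset.sum_product'] at hsum
    calc _ = _ := Finset.sum_congr rfl fun l hl =>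
          ((prod_map_weight a b q ((hS l).1 hl).2.1).2).symm
      _ = _ := hsum
      _ = _ := Finset.sum_congr rfl fun AB _ => by ring
end

section
/- (Main theorem: generalization of Dousse's theorem to m primary colors.) For every m ≥ 1 and all non-negative integers u_1, …, u_m, n, the cardinality of D(u_1,…,u_m,n) equals the cardinality of C(u_1,…,u_m,n), where D(u_1,…,u_m,n) is the set of finite sequences λ_1 ≫_c λ_2 ≫_c ⋯ ≫_c λ_s of parts in O' ∪ E' whose sizes sum to n and such that for each i ∈ {1,…,m}, u_i equals the number of primary parts of color a_i plus the number of secondary parts (k,p,q) with p = a_i plus the number of secondary parts (k,p,q) with q = a_i (so parts of color a_i² are counted twice); and C(u_1,…,u_m,n) is the set of m-tuples (A_1,…,A_m) of finite sets of positive integers with |A_i| = u_i for each i and with the sum of all elements of all the A_i equal to n. -/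
namespace CPart

variable {m : ℕ}

/-- The smallest size of the first part in a sequence of primary parts of sizes at least one with
the given word of colors, subject to `k - l ≥ delta p q` for consecutive `(k, p)`, `(l, q)`. -/
def minSize : List (Fin m) → ℤ
  | [] => 1
  | [_] => 1
  | p :: q :: c => delta p q + minSize (q :: c)

/-- The sum of the minimal sizes over all suffixes of a word of colors. -/
def minSizeSum : List (Fin m) → ℤ
  | [] => 0
  | p :: c => minSize (p :: c) + minSizeSum c

/-- The word of colors of a sequence of parts. -/
def word : List (CPart m) → List (Fin m)
  | [] => []
  | primary _ p :: l => p :: word l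
  | secondary _ p q :: l => p :: q :: word l

/-- The excesses of the primary parts over the minimal size at their position. -/
def primaryExcess : List (CPart m) → List ℤ
  | [] => []
  | primary k p :: l => (k - minSize (p :: word l)) :: primaryExcess l
  | secondary _ _ _ :: l => primaryExcess l

/-- The half excesses of the secondary parts over the minimal size at their position. -/
def secondaryExcess : List (CPart m) → List ℤ
  | [] => []
  | primary _ _ :: l => secondaryExcess l
  | secondary k _ q :: l => (k - minSize (q :: word l)) :: secondaryExcess l

lemma delta_nonneg (p q : Fin m) : 0 ≤ delta p q := by
  unfold delta; split <;> simp

lemma delta_le_one (p q : Fin m) : delta p q ≤ 1 := by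
  unfold delta; split <;> simp

lemma one_le_minSize : ∀ c : List (Fin m), 1 ≤ minSize c
  | [] => le_rfl
  | [_] => le_rfl
  | p :: q :: c => by
    have := one_le_minSize (q :: c)
    have := delta_nonneg p q
    simp only [minSize]; omega

lemma minSize_le_minSize_cons (p : Fin m) (c : List (Fin m)) : minSize c ≤ minSize (p :: c) := by
  cases c with
  | nil => simp [minSize]
  | cons q c => have := delta_nonneg p q; simp only [minSize]; omega

lemma minSize_cons_le (p : Fin m) (c : List (Fin m)) : minSize (p :: c) ≤ minSize c + 1 := by
  cases c with
  | nil => simp [minSize]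
  | cons q c => have := delta_le_one p q; simp only [minSize]; omega

lemma sum_size (l : List (CPart m)) :
    (l.map size).sum =
      (primaryExcess l).sum + 2 * (secondaryExcess l).sum + minSizeSum (word l) := by
  induction l with
  | nil => simp [primaryExcess, secondaryExcess, word, minSizeSum]
  | cons a l ih =>
    cases a <;>
      simp only [primaryExcess, secondaryExcess, word, minSizeSum, List.map_cons, List.sum_cons,
        size, minSize] <;> linarith

lemma length_word (l : List (CPart m)) :
    (word l).length = (primaryExcess l).length + 2 * (secondaryExcess l).length := by
  induction l with
  | nil => rfl
  | cons a l ih =>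
    cases a <;> simp only [primaryExcess, secondaryExcess, word, List.length_cons] <;> omega

lemma sum_colorCount (i : Fin m) (l : List (CPart m)) :
    (l.map (colorCount i)).sum = (word l).count i := by
  induction l with
  | nil => rfl
  | cons a l ih =>
    cases a <;>
      simp only [colorCount, word, List.map_cons, List.sum_cons, List.count_cons, ih, beq_iff_eq] <;>
      ring

lemma gg_primary_primary {k k' : ℤ} {p p' : Fin m} {l : List (CPart m)} :
    gg (primary k p) (primary k' p') ↔
      k' - minSize (p' :: word l) < k - minSize (p :: p' :: word l) := by
  simp only [gg, minSize]; omega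

lemma gg_primary_secondary {k k' : ℤ} {p p' q' : Fin m} {l : List (CPart m)} :
    gg (primary k p) (secondary k' p' q') ↔
      minSize (p' :: q' :: word l) ≤
        (k - minSize (p :: p' :: q' :: word l)) - 2 * (k' - minSize (q' :: word l)) := by
  simp only [gg, minSize]; omega

lemma gg_secondary_primary {k k' : ℤ} {p q p' : Fin m} {l : List (CPart m)} :
    gg (secondary k p q) (primary k' p') ↔
      (k' - minSize (p' :: word l)) - 2 * (k - minSize (q :: p' :: word l)) <
        minSize (q :: p' :: word l) := by
  simp only [gg, minSize]; omega

lemma gg_secondary_secondary {k k' : ℤ} {p q p' q' : Fin m} {l : List (CPart m)} :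
    gg (secondary k p q) (secondary k' p' q') ↔
      k' - minSize (q' :: word l) ≤ k - minSize (q :: p' :: q' :: word l) := by
  simp only [gg, minSize]; omega

lemma minSize_le_of_primary_first {l : List (CPart m)} :
    ∀ {k : ℤ} {p : Fin m}, (primary k p :: l).IsChain gg →
      ∀ y ∈ (secondaryExcess l).head?,
        minSize (word l) ≤ (k - minSize (p :: word l)) - 2 * y := by
  induction l with
  | nil => simp [secondaryExcess]
  | cons a l ih =>
    intro k p h y hy
    rw [List.isChain_cons_cons] at h
    cases a with
    | primary k' p' =>
      have h1 := (gg_primary_primary (l := l)).1 h.1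
      have h2 := ih h.2 y hy
      have h3 := minSize_cons_le p' (word l)
      simp only [word]; omega
    | secondary k' p' q' =>
      have h1 := (gg_primary_secondary (l := l)).1 h.1
      simp only [secondaryExcess, List.head?_cons, Option.mem_some_iff] at hy
      simp only [word]; omega

lemma lt_minSize_of_secondary_first {l : List (CPart m)} :
    ∀ {k : ℤ} {p q : Fin m}, (secondary k p q :: l).IsChain gg →
      ∀ x ∈ (primaryExcess l).head?,
        x - 2 * (k - minSize (q :: word l)) < minSize (q :: word l) := by
  induction l with
  | nil => simp [primaryExcess]
  | cons a l ih =>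
    intro k p q h x hx
    rw [List.isChain_cons_cons] at h
    cases a with
    | primary k' p' =>
      have h1 := (gg_secondary_primary (l := l)).1 h.1
      simp only [primaryExcess, List.head?_cons, Option.mem_some_iff] at hx
      simp only [word]; omega
    | secondary k' p' q' =>
      have h1 := (gg_secondary_secondary (l := l)).1 h.1
      have h2 := ih h.2 x hx
      have h3 := minSize_le_minSize_cons p' (q' :: word l)
      have h4 := minSize_le_minSize_cons q (p' :: q' :: word l)
      simp only [word]; omega

lemma isChain_primaryExcess {l : List (CPart m)} (h : l.IsChain gg) :
    (primaryExcess l).IsChain (· > ·) := by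
  induction l with
  | nil => exact .nil
  | cons a l ih =>
    have ih := ih h.tail
    cases a with
    | secondary k p q => exact ih
    | primary k p =>
      refine List.isChain_cons.2 ⟨fun x hx => ?_, ih⟩
      cases l with
      | nil => simp [primaryExcess] at hx
      | cons b l =>
        rw [List.isChain_cons_cons] at h
        cases b with
        | primary k' p' =>
          have h1 := (gg_primary_primary (l := l)).1 h.1
          simp only [primaryExcess, List.head?_cons, Option.mem_some_iff] at hx
          simp only [word]; omega
        | secondary k' p' q' =>
          have h1 := (gg_primary_secondary (l := l)).1 h.1
          have h2 := lt_minSize_of_secondary_first h.2 x hx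
          have h3 := minSize_le_minSize_cons p' (q' :: word l)
          simp only [word]; omega

lemma isChain_secondaryExcess {l : List (CPart m)} (h : l.IsChain gg) :
    (secondaryExcess l).IsChain (· ≥ ·) := by
  induction l with
  | nil => exact .nil
  | cons a l ih =>
    have ih := ih h.tail
    cases a with
    | primary k p => exact ih
    | secondary k p q =>
      refine List.isChain_cons.2 ⟨fun y hy => ?_, ih⟩
      cases l with
      | nil => simp [secondaryExcess] at hy
      | cons b l =>
        rw [List.isChain_cons_cons] at h
        cases b with
        | secondary k' p' q' =>
          have h1 := (gg_secondary_secondary (l := l)).1 h.1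
          simp only [secondaryExcess, List.head?_cons, Option.mem_some_iff] at hy
          simp only [word]; omega
        | primary k' p' =>
          have h1 := (gg_secondary_primary (l := l)).1 h.1
          have h2 := minSize_le_of_primary_first h.2 y hy
          have h3 := minSize_cons_le p' (word l)
          have h4 := minSize_cons_le q (p' :: word l)
          simp only [word]; omega

lemma eq_of_excess_eq {l : List (CPart m)} : ∀ {l' : List (CPart m)}, l.IsChain gg →
    l'.IsChain gg → word l = word l' → primaryExcess l = primaryExcess l' →
      secondaryExcess l = secondaryExcess l' → l = l' := by
  induction l with
  | nil =>
    intro l' _ _ hw _ _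
    cases l' with
    | nil => rfl
    | cons b l' => cases b <;> simp [word] at hw
  | cons a l ih =>
    intro l' h h' hw hx hy
    cases l' with
    | nil => cases a <;> simp [word] at hw
    | cons b l' =>
      cases a with
      | primary k p =>
        cases b with
        | primary k' p' =>
          simp only [word, primaryExcess, secondaryExcess, List.cons.injEq] at hw hx hy
          obtain ⟨rfl, hw⟩ := hw
          obtain rfl := ih h.tail h'.tail hw hx.2 hy
          simpa using hx.1
        | secondary k' p' q' =>
          simp only [word, primaryExcess, secondaryExcess, List.cons.injEq] at hw hx hy
          have h1 := minSize_le_of_primary_first h _ (by rw [hy]; rfl)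
          have h2 := lt_minSize_of_secondary_first h' _ (by rw [← hx]; rfl)
          rw [hw.2] at h1 h2
          omega
      | secondary k p q =>
        cases b with
        | primary k' p' =>
          simp only [word, primaryExcess, secondaryExcess, List.cons.injEq] at hw hx hy
          have h1 := minSize_le_of_primary_first h' _ (by rw [← hy]; rfl)
          have h2 := lt_minSize_of_secondary_first h _ (by rw [hx]; rfl)
          rw [← hw.2] at h1 h2
          omega
        | secondary k' p' q' =>
          simp only [word, primaryExcess, secondaryExcess, List.cons.injEq] at hw hx hy
          obtain ⟨rfl, rfl, hw⟩ := hw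
          obtain rfl := ih h.tail h'.tail hw hx hy.2
          simpa using hy.1

lemma isChain_primary_cons {x : ℤ} {p : Fin m} {l : List (CPart m)} (h : l.IsChain gg)
    (hx : ∀ x' ∈ (primaryExcess l).head?, x' < x)
    (hy : ∀ y ∈ (secondaryExcess l).head?, minSize (word l) ≤ x - 2 * y) :
    (primary (x + minSize (p :: word l)) p :: l).IsChain gg := by
  cases l with
  | nil => exact .singleton _
  | cons a l =>
    refine List.isChain_cons_cons.2 ⟨?_, h⟩
    cases a with
    | primary k' p' =>
      have := hx _ rfl
      refine (gg_primary_primary (l := l)).2 ?_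
      simp only [word]; omega
    | secondary k' p' q' =>
      have := hy _ rfl
      refine (gg_primary_secondary (l := l)).2 ?_
      simp only [word] at *; omega

lemma isChain_secondary_cons {y : ℤ} {p q : Fin m} {l : List (CPart m)} (h : l.IsChain gg)
    (hx : ∀ x ∈ (primaryExcess l).head?, x - 2 * y < minSize (q :: word l))
    (hy : ∀ y' ∈ (secondaryExcess l).head?, y' ≤ y) :
    (secondary (y + minSize (q :: word l)) p q :: l).IsChain gg := by
  cases l with
  | nil => exact .singleton _
  | cons a l =>
    refine List.isChain_cons_cons.2 ⟨?_, h⟩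
    cases a with
    | primary k' p' =>
      have := hx _ rfl
      refine (gg_secondary_primary (l := l)).2 ?_
      simp only [word] at *; omega
    | secondary k' p' q' =>
      have := hy _ rfl
      refine (gg_secondary_secondary (l := l)).2 ?_
      simp only [word]; omega

lemma exists_of_excess (n : ℕ) : ∀ (c : List (Fin m)) (X Y : List ℤ), c.length = n →
    c.length = X.length + 2 * Y.length → X.IsChain (· > ·) → Y.IsChain (· ≥ ·) →
      ∃ l : List (CPart m), l.IsChain gg ∧ word l = c ∧ primaryExcess l = X ∧
        secondaryExcess l = Y := by
  induction n using Nat.strong_induction_on with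
  | _ n ih =>
  have key_primary : ∀ p c x X Y, c.length < n → c.length = X.length + 2 * Y.length →
      (x :: X).IsChain (· > ·) → Y.IsChain (· ≥ ·) →
      (∀ y ∈ Y.head?, minSize c ≤ x - 2 * y) →
      ∃ l : List (CPart m), l.IsChain gg ∧ word l = p :: c ∧ primaryExcess l = x :: X ∧
        secondaryExcess l = Y := by
    intro p c x X Y hlt hc hX hY hxy
    obtain ⟨l, hl, rfl, rfl, rfl⟩ := ih _ hlt c X Y rfl hc hX.tail hY
    refine ⟨_, isChain_primary_cons (p := p) hl (List.isChain_cons.1 hX).1 hxy, ?_, ?_, ?_⟩ <;>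
      simp [word, primaryExcess, secondaryExcess]
  have key_secondary : ∀ p q c X y Y, c.length < n → c.length = X.length + 2 * Y.length →
      X.IsChain (· > ·) → (y :: Y).IsChain (· ≥ ·) →
      (∀ x ∈ X.head?, x - 2 * y < minSize (q :: c)) →
      ∃ l : List (CPart m), l.IsChain gg ∧ word l = p :: q :: c ∧ primaryExcess l = X ∧
        secondaryExcess l = y :: Y := by
    intro p q c X y Y hlt hc hX hY hxy
    obtain ⟨l, hl, rfl, rfl, rfl⟩ := ih _ hlt c X Y rfl hc hX hY.tail
    refine ⟨_, isChain_secondary_cons (p := p) (q := q) hl hxy (List.isChain_cons.1 hY).1,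
      ?_, ?_, ?_⟩ <;> simp [word, primaryExcess, secondaryExcess]
  intro c X Y hn hc hX hY
  match c, X, Y, hn, hc, hX, hY with
  | [], [], [], _, _, _, _ => exact ⟨[], .nil, rfl, rfl, rfl⟩
  | [], _ :: _, _, _, hc, _, _ => simp at hc; omega
  | [], [], _ :: _, _, hc, _, _ => simp at hc
  | _ :: _, [], [], _, hc, _, _ => simp at hc
  | p :: c, x :: X, [], hn, hc, hX, _ =>
    exact key_primary p c x X [] (by simp at hn; omega) (by simp at hc ⊢; omega) hX .nil (by simp)
  | [_], [], _ :: _, _, hc, _, _ => simp at hc; omega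
  | [_], _ :: _, _ :: _, _, hc, _, _ => simp at hc; omega
  | p :: q :: c, [], y :: Y, hn, hc, _, hY =>
    exact key_secondary p q c [] y Y (by simp at hn; omega) (by simp at hc ⊢; omega) .nil hY
      (by simp)
  | p :: q :: c, x :: X, y :: Y, hn, hc, hX, hY =>
    by_cases hxy : minSize (q :: c) ≤ x - 2 * y
    · exact key_primary p (q :: c) x X (y :: Y) (by simp at hn ⊢; omega)
        (by simp at hc ⊢; omega) hX hY (by simpa using hxy)
    · exact key_secondary p q c (x :: X) y Y (by simp at hn; omega) (by simp at hc ⊢; omega)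
        hX hY (by simpa using hxy)

lemma excess_nonneg {l : List (CPart m)} (h : l.IsChain gg) (hl : ∀ a ∈ l, a.mem') :
    (∀ x ∈ primaryExcess l, 0 ≤ x) ∧ ∀ y ∈ secondaryExcess l, 0 ≤ y := by
  suffices H : ((∀ x ∈ primaryExcess l, 0 ≤ x) ∧ ∀ y ∈ secondaryExcess l, 0 ≤ y) ∧
      ∀ k p, l.head? = some (primary k p) → 2 * minSize (word l) - 1 ≤ k from H.1
  induction l with
  | nil => simp [primaryExcess, secondaryExcess]
  | cons a l ih =>
    obtain ⟨⟨hx, hy⟩, hk⟩ := ih h.tail fun b hb => hl b (List.mem_cons_of_mem _ hb)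
    have ha := hl a List.mem_cons_self
    cases a with
    | primary k p =>
      simp only [mem'] at ha
      have key : 2 * minSize (p :: word l) - 1 ≤ k := by
        cases l with
        | nil => simp only [word, minSize]; omega
        | cons b l =>
          rw [List.isChain_cons_cons] at h
          cases b with
          | primary k' p' =>
            have h1 := (gg_primary_primary (l := l)).1 h.1
            have h2 := hk _ _ rfl
            have h3 := minSize_cons_le p (p' :: word l)
            simp only [word] at *; omega
          | secondary k' p' q' =>
            have h1 := (gg_primary_secondary (l := l)).1 h.1
            have h2 := hy _ List.mem_cons_self
            have h3 := minSize_cons_le p (p' :: q' :: word l)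
            simp only [word] at *; omega
      refine ⟨⟨?_, hy⟩, ?_⟩
      · intro x hx'
        rcases List.mem_cons.1 hx' with rfl | hx'
        · have := one_le_minSize (p :: word l); omega
        · exact hx x hx'
      · rintro k' p' h'
        simp only [List.head?_cons, Option.some.injEq, primary.injEq] at h'
        obtain ⟨rfl, rfl⟩ := h'
        exact key
    | secondary k p q =>
      simp only [mem'] at ha
      refine ⟨⟨hx, ?_⟩, by simp⟩
      intro y hy'
      rcases List.mem_cons.1 hy' with rfl | hy'
      · cases l with
        | nil => simp only [word, minSize]; omega
        | cons b l =>
          rw [List.isChain_cons_cons] at h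
          cases b with
          | primary k' p' =>
            have h1 := (gg_secondary_primary (l := l)).1 h.1
            have h2 := hk _ _ rfl
            have h3 := minSize_cons_le q (p' :: word l)
            simp only [word] at *; omega
          | secondary k' p' q' =>
            have h1 := (gg_secondary_secondary (l := l)).1 h.1
            have h2 := hy _ List.mem_cons_self
            simp only [word] at *; omega
      · exact hy y hy'

lemma mem'_of_excess_nonneg {l : List (CPart m)} (hx : ∀ x ∈ primaryExcess l, 0 ≤ x)
    (hy : ∀ y ∈ secondaryExcess l, 0 ≤ y) : ∀ a ∈ l, a.mem' := by
  induction l with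
  | nil => simp
  | cons a l ih =>
    cases a with
    | primary k p =>
      simp only [primaryExcess, secondaryExcess, List.forall_mem_cons] at hx hy
      have := one_le_minSize (p :: word l)
      exact List.forall_mem_cons.2 ⟨by simp only [mem']; omega, ih hx.2 hy⟩
    | secondary k p q =>
      simp only [primaryExcess, secondaryExcess, List.forall_mem_cons] at hx hy
      have := one_le_minSize (q :: word l)
      exact List.forall_mem_cons.2 ⟨by simp only [mem']; omega, ih hx hy.2⟩

/-- The multiset of excesses, those of the secondary parts being taken twice. -/
def excess (l : List (CPart m)) : Multiset ℤ :=
  (primaryExcess l : Multiset ℤ) + 2 • (secondaryExcess l : Multiset ℤ)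

lemma eq_and_eq_of_add_two_nsmul_eq {α : Type*} {s s' t t' : Multiset α} (hs : s.Nodup)
    (hs' : s'.Nodup) (h : s + 2 • t = s' + 2 • t') : s = s' ∧ t = t' := by
  classical
  have key : ∀ a, s.count a = s'.count a ∧ t.count a = t'.count a := fun a => by
    have h1 := congrArg (Multiset.count a) h
    simp only [Multiset.count_add, Multiset.count_nsmul] at h1
    have h2 := Multiset.nodup_iff_count_le_one.1 hs a
    have h3 := Multiset.nodup_iff_count_le_one.1 hs' a
    omega
  exact ⟨Multiset.ext.2 fun a => (key a).1, Multiset.ext.2 fun a => (key a).2⟩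

lemma exists_nodup_add_two_nsmul {α : Type*} (s : Multiset α) :
    ∃ t u : Multiset α, t.Nodup ∧ s = t + 2 • u := by
  classical
  induction s using Multiset.induction with
  | empty => exact ⟨0, 0, by simp⟩
  | cons a s ih =>
    obtain ⟨t, u, ht, rfl⟩ := ih
    by_cases ha : a ∈ t
    · refine ⟨t.erase a, a ::ₘ u, ht.erase a, ?_⟩
      obtain ⟨t, rfl⟩ := Multiset.exists_cons_of_mem ha
      simp [two_nsmul]
    · exact ⟨a ::ₘ t, u, Multiset.nodup_cons.2 ⟨ha, ht⟩, by simp⟩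

/-- Pairs of a word of colors with the prescribed color counts and an equally large multiset of
nonnegative integers, of prescribed total size. -/
abbrev WordWithExcess (u : Fin m → ℕ) (n : ℕ) : Type :=
  {cs : List (Fin m) × Multiset ℤ // Multiset.card cs.2 = cs.1.length ∧ (∀ x ∈ cs.2, 0 ≤ x) ∧
    cs.2.sum + minSizeSum cs.1 = n ∧ ∀ i, cs.1.count i = u i}

theorem card_chains_eq_card_wordWithExcess (u : Fin m → ℕ) (n : ℕ) :
    Nat.card {l : List (CPart m) // l.IsChain gg ∧ (∀ x ∈ l, x.mem') ∧
      (l.map CPart.size).sum = (n : ℤ) ∧ ∀ i : Fin m, (l.map (colorCount i)).sum = u i} =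
    Nat.card (WordWithExcess u n) := by
  refine Nat.card_eq_of_bijective (fun l => ⟨(word l.1, excess l.1), ?_, ?_, ?_, ?_⟩) ⟨?_, ?_⟩
  · simp [excess, length_word]
  · have := excess_nonneg l.2.1 l.2.2.1
    simp only [excess, two_nsmul, Multiset.mem_add, Multiset.mem_coe]
    rintro x (hx | hx | hx)
    exacts [this.1 x hx, this.2 x hx, this.2 x hx]
  · have := sum_size l.1
    rw [l.2.2.2.1] at this
    simp [excess, this, two_nsmul, two_mul]
  · intro i
    rw [← l.2.2.2.2 i, sum_colorCount]
  · rintro ⟨l, hl, _⟩ ⟨l', hl', _⟩ h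
    simp only [Subtype.mk.injEq, Prod.mk.injEq] at h
    have hX := (List.isChain_iff_pairwise.1 (isChain_primaryExcess hl))
    have hX' := (List.isChain_iff_pairwise.1 (isChain_primaryExcess hl'))
    have hY := (List.isChain_iff_pairwise.1 (isChain_secondaryExcess hl))
    have hY' := (List.isChain_iff_pairwise.1 (isChain_secondaryExcess hl'))
    obtain ⟨h1, h2⟩ := eq_and_eq_of_add_two_nsmul_eq
      (Multiset.coe_nodup.2 (hX.imp fun h => h.ne'))
      (Multiset.coe_nodup.2 (hX'.imp fun h => h.ne')) h.2
    have h1 := (Multiset.coe_eq_coe.1 h1).eq_of_pairwise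
      (fun a b _ _ hab hba => absurd hab hba.asymm) hX hX'
    have h2 := (Multiset.coe_eq_coe.1 h2).eq_of_pairwise
      (fun a b _ _ hab hba => le_antisymm hba hab) hY hY'
    exact Subtype.ext (eq_of_excess_eq hl hl' h.1 h1 h2)
  · rintro ⟨⟨c, s⟩, hcard, hpos, hsum, hcount⟩
    obtain ⟨t, v, ht, rfl⟩ := exists_nodup_add_two_nsmul s
    have hts : (t.sort (· ≥ ·)).Pairwise (· > ·) := by
      have h1 := t.pairwise_sort (· ≥ ·)
      have h2 : (t.sort (· ≥ ·)).Nodup := by rwa [← Multiset.coe_nodup, Multiset.sort_eq]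
      exact (h1.and h2).imp fun h => lt_of_le_of_ne h.1 h.2.symm
    obtain ⟨l, hl, hw, hX, hY⟩ := exists_of_excess c.length c (t.sort (· ≥ ·)) (v.sort (· ≥ ·))
      rfl (by simpa using hcard.symm) (List.isChain_iff_pairwise.2 hts)
      (List.isChain_iff_pairwise.2 (v.pairwise_sort (· ≥ ·)))
    have he : excess l = t + 2 • v := by simp [excess, hX, hY]
    refine ⟨⟨l, hl, mem'_of_excess_nonneg ?_ ?_, ?_, ?_⟩, ?_⟩
    · intro x hx
      exact hpos x (by rw [← he]; simp [excess, hx])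
    · intro x hx
      exact hpos x (by rw [← he]; simp [excess, two_nsmul, hx])
    · rw [← hsum, sum_size, ← he, ← hw]
      simp [excess, two_nsmul, two_mul]
    · intro i
      rw [sum_colorCount, hw, hcount]
    · simp only [he, hw]

/-- The excesses of a sequence of colored integers over the minimal sizes at their positions. -/
def lexExcess : List (ℕ ×ₗ Fin m) → List ℤ
  | [] => []
  | a :: L => ((ofLex a).1 - minSize ((ofLex a).2 :: L.map fun b => (ofLex b).2)) :: lexExcess L

lemma length_lexExcess (L : List (ℕ ×ₗ Fin m)) : (lexExcess L).length = L.length := by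
  induction L with
  | nil => rfl
  | cons a L ih => simp [lexExcess, ih]

lemma sum_lexExcess (L : List (ℕ ×ₗ Fin m)) :
    (lexExcess L).sum + minSizeSum (L.map fun b => (ofLex b).2) =
      ((L.map fun b => (ofLex b).1).sum : ℕ) := by
  induction L with
  | nil => rfl
  | cons a L ih =>
    simp only [lexExcess, List.map_cons, List.sum_cons, minSizeSum, Nat.cast_add, ← ih]; ring

lemma lt_iff_excess_le {a b : ℕ ×ₗ Fin m} {c : List (Fin m)} :
    b < a ↔ ((ofLex b).1 : ℤ) - minSize ((ofLex b).2 :: c) ≤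
      (ofLex a).1 - minSize ((ofLex a).2 :: (ofLex b).2 :: c) := by
  simp only [Prod.Lex.lt_iff, minSize, delta]
  split_ifs with h
  · have := h.not_gt
    simp only [this, and_false, or_false]; omega
  · have := not_le.1 h
    simp only [this, and_true]; omega

lemma isChain_lexExcess {L : List (ℕ ×ₗ Fin m)} :
    (lexExcess L).IsChain (· ≥ ·) ↔ L.IsChain (· > ·) := by
  induction L with
  | nil => simp [lexExcess]
  | cons a L ih =>
    cases L with
    | nil => simp [lexExcess]
    | cons b L =>
      simp only [lexExcess, List.isChain_cons_cons, List.map_cons] at ih ⊢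
      rw [ih]
      exact and_congr_left' lt_iff_excess_le.symm

lemma lexExcess_nonneg {L : List (ℕ ×ₗ Fin m)} (h : L.IsChain (· > ·))
    (hL : ∀ a ∈ L, 0 < (ofLex a).1) : ∀ x ∈ lexExcess L, 0 ≤ x := by
  induction L with
  | nil => simp [lexExcess]
  | cons a L ih =>
    have ih := ih h.tail fun b hb => hL b (List.mem_cons_of_mem _ hb)
    refine List.forall_mem_cons.2 ⟨?_, ih⟩
    cases L with
    | nil =>
      have := hL a List.mem_cons_self
      simp only [List.map_nil, minSize]; omega
    | cons b L =>
      have := (lt_iff_excess_le (c := L.map fun b => (ofLex b).2)).1 (List.isChain_cons_cons.1 h).1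
      exact (ih _ List.mem_cons_self).trans this

lemma exists_of_lexExcess : ∀ (c : List (Fin m)) (N : List ℤ), N.length = c.length →
    (∀ x ∈ N, 0 ≤ x) → ∃ L : List (ℕ ×ₗ Fin m), (L.map fun b => (ofLex b).2) = c ∧
      lexExcess L = N ∧ ∀ a ∈ L, 0 < (ofLex a).1
  | [], [], _, _ => ⟨[], rfl, rfl, by simp⟩
  | p :: c, x :: N, h, hN => by
    obtain ⟨L, rfl, rfl, hL⟩ := exists_of_lexExcess c N (by simpa using h)
      fun y hy => hN y (List.mem_cons_of_mem _ hy)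
    have h1 := hN x List.mem_cons_self
    have h2 := one_le_minSize (p :: L.map fun b => (ofLex b).2)
    refine ⟨toLex ((x + minSize (p :: L.map fun b => (ofLex b).2)).toNat, p) :: L, rfl, ?_, ?_⟩
    · simp only [lexExcess, ofLex_toLex, List.cons.injEq, and_true]; omega
    · refine List.forall_mem_cons.2 ⟨?_, hL⟩
      simp only [ofLex_toLex]; omega

lemma eq_of_lexExcess_eq {L : List (ℕ ×ₗ Fin m)} : ∀ {L' : List (ℕ ×ₗ Fin m)},
    (L.map fun b => (ofLex b).2) = (L'.map fun b => (ofLex b).2) →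
      lexExcess L = lexExcess L' → L = L' := by
  induction L with
  | nil =>
    intro L' h _
    simpa using h.symm
  | cons a L ih =>
    intro L' h h'
    cases L' with
    | nil => simp at h
    | cons b L' =>
      simp only [List.map_cons, List.cons.injEq, lexExcess] at h h'
      obtain rfl := ih h.2 h'.2
      have h1 := h'.1
      rw [h.1, sub_left_inj, Nat.cast_inj] at h1
      rw [List.cons.injEq]
      exact ⟨ofLex.injective (Prod.ext h1 h.1), rfl⟩

/-- The finite set of colored integers whose integers of color `i` are the elements of `A i`. -/
def coloredFinset (A : Fin m → Finset ℕ) : Finset (ℕ ×ₗ Fin m) :=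
  (Finset.univ.sigma A).map ⟨fun a => toLex (a.2, a.1), fun a b h => by
    have := toLex.injective h
    cases a; cases b; simp_all⟩

lemma mem_coloredFinset {A : Fin m → Finset ℕ} {a : ℕ ×ₗ Fin m} :
    a ∈ coloredFinset A ↔ (ofLex a).1 ∈ A (ofLex a).2 := by
  simp only [coloredFinset, Finset.mem_map, Finset.mem_sigma, Finset.mem_univ, true_and]
  constructor
  · rintro ⟨b, hb, rfl⟩
    exact hb
  · exact fun h => ⟨⟨(ofLex a).2, (ofLex a).1⟩, h, rfl⟩

lemma sum_map_sort_coloredFinset {M : Type*} [AddCommMonoid M] (A : Fin m → Finset ℕ)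
    (f : ℕ ×ₗ Fin m → M) :
    (((coloredFinset A).sort (· ≥ ·)).map f).sum = ∑ i, ∑ k ∈ A i, f (toLex (k, i)) := by
  rw [← List.sum_toFinset f (Finset.sort_nodup _ _), Finset.sort_toFinset, coloredFinset,
    Finset.sum_map, Finset.sum_sigma]
  rfl

lemma count_map_sort_coloredFinset (A : Fin m → Finset ℕ) (i : Fin m) :
    (((coloredFinset A).sort (· ≥ ·)).map fun b => (ofLex b).2).count i = (A i).card := by
  have h : ∀ L : List (ℕ ×ₗ Fin m), (L.map fun b => (ofLex b).2).count i =
      (L.map fun b => if (ofLex b).2 = i then 1 else 0).sum := fun L => by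
    induction L with
    | nil => rfl
    | cons a L ih => simp only [List.map_cons, List.count_cons, ih, List.sum_cons, beq_iff_eq,
        add_comm]
  rw [h, sum_map_sort_coloredFinset]
  calc _ = ∑ j, if j = i then (A j).card else 0 := Finset.sum_congr rfl fun j _ => by
        by_cases hj : j = i <;> simp [hj]
    _ = (A i).card := by simp

theorem card_coloredSets_eq_card_wordWithExcess (u : Fin m → ℕ) (n : ℕ) :
    Nat.card {A : Fin m → Finset ℕ // (∀ i, ∀ x ∈ A i, 0 < x) ∧ (∀ i, (A i).card = u i) ∧
      (∑ i, (A i).sum id) = n} =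
    Nat.card (WordWithExcess u n) := by
  have hchain (A : Fin m → Finset ℕ) : ((coloredFinset A).sort (· ≥ ·)).IsChain (· > ·) :=
    List.isChain_iff_pairwise.2 (Finset.sortedGT_sort _).pairwise
  refine Nat.card_eq_of_bijective (fun A => ⟨(((coloredFinset A.1).sort (· ≥ ·)).map
    fun b => (ofLex b).2, lexExcess ((coloredFinset A.1).sort (· ≥ ·))), ?_, ?_, ?_, ?_⟩) ⟨?_, ?_⟩
  · simp [length_lexExcess]
  · refine lexExcess_nonneg (hchain A.1) fun a ha => A.2.1 (ofLex a).2 _ ?_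
    rwa [Finset.mem_sort, mem_coloredFinset] at ha
  · rw [Multiset.sum_coe, sum_lexExcess, sum_map_sort_coloredFinset]
    exact congrArg _ A.2.2.2
  · exact fun i => (count_map_sort_coloredFinset A.1 i).trans (A.2.2.1 i)
  · rintro ⟨A, hA⟩ ⟨A', hA'⟩ h
    simp only [Subtype.mk.injEq, Prod.mk.injEq] at h
    have h2 := (Multiset.coe_eq_coe.1 h.2).eq_of_pairwise
      (fun a b _ _ hab hba => le_antisymm hba hab)
      (List.isChain_iff_pairwise.1 (isChain_lexExcess.2 (hchain A)))
      (List.isChain_iff_pairwise.1 (isChain_lexExcess.2 (hchain A')))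
    have h3 := congrArg List.toFinset (eq_of_lexExcess_eq h.1 h2)
    rw [Finset.sort_toFinset, Finset.sort_toFinset] at h3
    refine Subtype.ext (funext fun i => Finset.ext fun k => ?_)
    have := congrArg (toLex (k, i) ∈ ·) h3
    simpa [mem_coloredFinset] using this
  · rintro ⟨⟨c, s⟩, hcard, hpos, hsum, hcount⟩
    obtain ⟨L, rfl, hN, hL⟩ := exists_of_lexExcess c (s.sort (· ≥ ·)) (by simpa using hcard)
      (by simpa using hpos)
    have hLc : L.Pairwise (· > ·) := by
      rw [← List.isChain_iff_pairwise, ← isChain_lexExcess, hN]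
      exact List.isChain_iff_pairwise.2 (s.pairwise_sort (· ≥ ·))
    have hs : (lexExcess L : Multiset ℤ) = s := by rw [hN, Multiset.sort_eq]
    let A : Fin m → Finset ℕ := fun i =>
      (L.toFinset.filter fun a => (ofLex a).2 = i).image fun a => (ofLex a).1
    have hA : coloredFinset A = L.toFinset := by
      ext a
      simp only [mem_coloredFinset, A, Finset.mem_image, Finset.mem_filter]
      constructor
      · rintro ⟨b, ⟨hb, h2⟩, h1⟩
        rwa [← show b = a from ofLex.injective (Prod.ext h1 h2)]
      · exact fun h => ⟨a, ⟨h, rfl⟩, rfl⟩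
    have hsort : (coloredFinset A).sort (· ≥ ·) = L := by
      rw [hA, List.toFinset_sort _ (hLc.imp fun h => h.ne')]
      exact hLc.imp fun h => le_of_lt h
    refine ⟨⟨A, ?_, ?_, ?_⟩, ?_⟩
    · intro i k hk
      have : toLex (k, i) ∈ coloredFinset A := mem_coloredFinset.2 hk
      rw [hA, List.mem_toFinset] at this
      exact hL _ this
    · intro i
      rw [← count_map_sort_coloredFinset, hsort, hcount]
    · have := sum_map_sort_coloredFinset A fun b => (ofLex b).1
      rw [hsort] at this
      rw [← Nat.cast_inj (R := ℤ), ← hsum, ← hs, Multiset.sum_coe, sum_lexExcess, this]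
      rfl
    · simp only [hsort, hs]

end CPart

/-- The main theorem: generalization of Dousse's theorem to m primary colors. -/
theorem dousse_m_colors (m : ℕ) (hm : 1 ≤ m) (u : Fin m → ℕ) (n : ℕ) :
    Nat.card {l : List (CPart m) //
      l.Chain' gg ∧ (∀ x ∈ l, x.mem') ∧
      (l.map CPart.size).sum = (n : ℤ) ∧
      ∀ i : Fin m, (l.map (colorCount i)).sum = u i} =
    Nat.card {A : Fin m → Finset ℕ //
      (∀ i, ∀ x ∈ A i, 0 < x) ∧ (∀ i, (A i).card = u i) ∧
      (∑ i, (A i).sum id) = n} := by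
  rw [CPart.card_coloredSets_eq_card_wordWithExcess]
  exact CPart.card_chains_eq_card_wordWithExcess u n
end

section
/- (Uniqueness of the selection of troublesome pairs.) Let λ_1 >_c λ_2 >_c ⋯ >_c λ_s be a finite sequence of primary parts λ_i = (l_i, c_i) with l_i ≥ 1, strictly decreasing for >_c. Then there exists a unique pair of subsets I, J of {1,…,s} such that: (1) I, I+1 = {i+1 : i ∈ I}, and J are pairwise disjoint and their union is {1,…,s}; (2) for every i ∈ I, l_i − l_{i+1} = δ(c_i, c_{i+1}) (i.e. λ_i and λ_{i+1} are consecutive for >_c); and (3) for every j ∈ J with j ≤ s−1, l_j − l_{j+1} ≥ 1 + δ(c_j, c_{j+1}) (i.e. λ_j ≫_c λ_{j+1}). -/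
/-- The greedy selection in `{1,…,s}`: `k + 1` is selected when `T (k + 1)` holds, `k + 2 ≤ s`
and `k` is not selected. -/
def greedySelection (T : ℕ → Prop) (s : ℕ) : ℕ → Prop
  | 0 => False
  | k + 1 => T (k + 1) ∧ k + 2 ≤ s ∧ ¬ greedySelection T s k

theorem mem_iff_greedySelection {T : ℕ → Prop} {s : ℕ} {I J : Finset ℕ}
    (hdisj : Disjoint I (I.image (· + 1)))
    (hunion : I ∪ I.image (· + 1) ∪ J = Finset.Icc 1 s)
    (hI : ∀ i ∈ I, T i) (hJ : ∀ j ∈ J, j + 1 ≤ s → ¬ T j) (k : ℕ) :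
    k ∈ I ↔ greedySelection T s k := by
  have hmem (k : ℕ) : ((k ∈ I ∨ k ∈ I.image (· + 1)) ∨ k ∈ J) ↔ 1 ≤ k ∧ k ≤ s := by
    rw [← Finset.mem_Icc, ← hunion, Finset.mem_union, Finset.mem_union]
  have hsucc (k : ℕ) : k + 1 ∈ I.image (· + 1) ↔ k ∈ I := by simp
  induction k with
  | zero =>
    have := hmem 0
    simp only [greedySelection, iff_false]
    intro h
    simp [h] at this
  | succ k ih =>
    simp only [greedySelection, ← ih]
    constructor
    · intro h
      refine ⟨hI _ h, ((hmem (k + 2)).1 (.inl (.inr ((hsucc (k + 1)).2 h)))).2, fun hk => ?_⟩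
      exact Finset.disjoint_left.1 hdisj h ((hsucc k).2 hk)
    · rintro ⟨hT, hs, hk⟩
      rcases (hmem (k + 1)).2 ⟨by omega, by omega⟩ with (h | h) | h
      · exact h
      · exact absurd ((hsucc k).1 h) hk
      · exact absurd hT (hJ _ h hs)

/-- A pair of sets `I`, `J` such that `I`, `I + 1`, `J` partition `{1,…,s}`, with `T` on `I` and
`¬ T` on `J` except possibly at `s`, exists and is unique. -/
theorem existsUnique_selection (T : ℕ → Prop) (s : ℕ) :
    ∃! IJ : Finset ℕ × Finset ℕ,
      (Disjoint IJ.1 (IJ.1.image (· + 1)) ∧ Disjoint IJ.1 IJ.2 ∧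
        Disjoint (IJ.1.image (· + 1)) IJ.2 ∧
        IJ.1 ∪ IJ.1.image (· + 1) ∪ IJ.2 = Finset.Icc 1 s) ∧
      (∀ i ∈ IJ.1, T i) ∧ (∀ j ∈ IJ.2, j + 1 ≤ s → ¬ T j) := by
  classical
  set I := (Finset.Icc 1 s).filter (greedySelection T s) with hI
  have hmem (k : ℕ) : k ∈ I ↔ greedySelection T s k := by
    cases k with
    | zero => simp [hI, greedySelection]
    | succ k =>
      simp only [hI, Finset.mem_filter, Finset.mem_Icc, greedySelection]
      constructor
      · exact fun h => h.2
      · exact fun h => ⟨⟨by omega, by omega⟩, h⟩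
  have hsucc (k : ℕ) : k + 1 ∈ I ↔ T (k + 1) ∧ k + 2 ≤ s ∧ k ∉ I := by
    rw [hmem, hmem, greedySelection]
  have hzero : 0 ∉ I := by simp [hI]
  have himage (k : ℕ) : k + 1 ∈ I.image (· + 1) ↔ k ∈ I := by simp
  have hle : I ∪ I.image (· + 1) ⊆ Finset.Icc 1 s := by
    intro k hk
    rw [Finset.mem_union] at hk
    rcases hk with hk | hk
    · exact (Finset.mem_filter.1 hk).1
    · obtain ⟨i, hi, rfl⟩ := Finset.mem_image.1 hk
      cases i with
      | zero => exact absurd hi hzero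
      | succ i =>
        have := ((hsucc i).1 hi).2.1
        simp only [Finset.mem_Icc]
        omega
  have hdisj : Disjoint (I ∪ I.image (· + 1)) (Finset.Icc 1 s \ (I ∪ I.image (· + 1))) :=
    Finset.disjoint_sdiff
  rw [Finset.disjoint_union_left] at hdisj
  refine ⟨(I, Finset.Icc 1 s \ (I ∪ I.image (· + 1))), ⟨⟨?_, hdisj.1, hdisj.2,
    Finset.union_sdiff_of_subset hle⟩, ?_, ?_⟩, ?_⟩
  · refine Finset.disjoint_left.2 fun k hk hk' => ?_
    obtain ⟨i, hi, rfl⟩ := Finset.mem_image.1 hk'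
    exact ((hsucc i).1 hk).2.2 hi
  · intro i hi
    cases i with
    | zero => exact absurd hi hzero
    | succ i => exact ((hsucc i).1 hi).1
  · intro j hj hjs hT
    obtain ⟨hj1, hj2⟩ := Finset.mem_sdiff.1 hj
    obtain ⟨k, rfl⟩ := Nat.exists_eq_add_of_le' (Finset.mem_Icc.1 hj1).1
    rw [Finset.mem_union, himage] at hj2
    exact hj2 (.inl ((hsucc k).2 ⟨hT, hjs, fun hk => hj2 (.inr hk)⟩))
  · rintro ⟨I', J'⟩ ⟨⟨h₁, h₂, h₃, h₄⟩, h₅, h₆⟩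
    dsimp only at *
    have hII : I' = I := by
      ext k
      rw [hmem, mem_iff_greedySelection h₁ h₄ h₅ h₆]
    subst hII
    rw [← h₄, Finset.union_sdiff_cancel_left (Finset.disjoint_union_left.2 ⟨h₂, h₃⟩)]

/-- Uniqueness of the selection of troublesome pairs: for a strictly >_c-decreasing
sequence of primary parts (l k, c k), k ∈ {1,…,s}, there is a unique pair (I, J)
of subsets of {1,…,s} such that I, I+1, J partition {1,…,s}, each i ∈ I gives a
pair consecutive for >_c, and each j ∈ J (with j ≤ s−1) satisfies λ_j ≫_c λ_{j+1}. -/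
theorem selection_unique (m : ℕ) (hm : 1 ≤ m) (s : ℕ) (l : ℕ → ℤ) (c : ℕ → Fin m)
    (hpos : ∀ k ∈ Finset.Icc 1 s, 1 ≤ l k)
    (hdec : ∀ k, 1 ≤ k → k + 1 ≤ s → l k - l (k + 1) ≥ delta (c k) (c (k + 1))) :
    ∃! IJ : Finset ℕ × Finset ℕ,
      (Disjoint IJ.1 (IJ.1.image (· + 1)) ∧ Disjoint IJ.1 IJ.2 ∧
        Disjoint (IJ.1.image (· + 1)) IJ.2 ∧
        IJ.1 ∪ IJ.1.image (· + 1) ∪ IJ.2 = Finset.Icc 1 s) ∧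
      (∀ i ∈ IJ.1, l i - l (i + 1) = delta (c i) (c (i + 1))) ∧
      (∀ j ∈ IJ.2, j + 1 ≤ s → l j - l (j + 1) ≥ 1 + delta (c j) (c (j + 1))) := by
  refine (existsUnique_congr fun IJ => and_congr_right fun h => and_congr_right fun _ => ?_).2
    (existsUnique_selection (fun k => l k - l (k + 1) = delta (c k) (c (k + 1))) s)
  refine forall₃_congr fun j hj hjs => ?_
  have hj1 : j ∈ Finset.Icc 1 s := h.2.2.2 ▸ Finset.mem_union_right _ hj
  have := hdec j (Finset.mem_Icc.1 hj1).1 hjs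
  omega
end

section
/- (Gap inequality after selection of troublesome pairs.) Let λ_1 >_c λ_2 >_c ⋯ >_c λ_s be a strictly >_c-decreasing sequence of primary parts λ_i = (l_i, c_i) with l_i ≥ 1, and let I, J ⊆ {1,…,s} be subsets such that I, I+1, J partition {1,…,s}, l_i − l_{i+1} = δ(c_i, c_{i+1}) for all i ∈ I, and l_j − l_{j+1} ≥ 1 + δ(c_j, c_{j+1}) for all j ∈ J with j ≤ s−1. Define Δ(i,j) = Σ_{k=i}^{j−1} χ(c_k ≤ c_{k+1}) and α(i,j) = |[i,j) ∩ J| for i ≤ j. Then for all 1 ≤ i ≤ j ≤ s, l_i − l_j ≥ α(i,j) + Δ(i,j). -/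
/-- Δ(i,j) = Σ_{k=i}^{j-1} χ(c_k ≤ c_{k+1}) (for i ≤ j). -/
def Del {m : ℕ} (c : ℕ → Fin m) (i j : ℕ) : ℤ :=
  ∑ k ∈ Finset.Ico i j, (if c k ≤ c (k + 1) then (1 : ℤ) else 0)

/-- Gap inequality after selection of troublesome pairs:
l_i − l_j ≥ α(i,j) + Δ(i,j) where α(i,j) = |[i,j) ∩ J|. -/
theorem gap_inequality (m : ℕ) (hm : 1 ≤ m) (s : ℕ) (l : ℕ → ℤ) (c : ℕ → Fin m)
    (I J : Finset ℕ)
    (hpos : ∀ k ∈ Finset.Icc 1 s, 1 ≤ l k)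
    (hdec : ∀ k, 1 ≤ k → k + 1 ≤ s → l k - l (k + 1) ≥ delta (c k) (c (k + 1)))
    (hd1 : Disjoint I (I.image (· + 1))) (hd2 : Disjoint I J)
    (hd3 : Disjoint (I.image (· + 1)) J)
    (hcover : I ∪ I.image (· + 1) ∪ J = Finset.Icc 1 s)
    (hI : ∀ i ∈ I, l i - l (i + 1) = delta (c i) (c (i + 1)))
    (hJ : ∀ j ∈ J, j + 1 ≤ s → l j - l (j + 1) ≥ 1 + delta (c j) (c (j + 1))) :
    ∀ i j, 1 ≤ i → i ≤ j → j ≤ s →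
      l i - l j ≥ (((Finset.Ico i j).filter (· ∈ J)).card : ℤ) + Del c i j := by
  intro i j hi hij
  induction j, hij using Nat.le_induction with
  | base => simp [Del]
  | succ j hij ih =>
    intro hj
    have hle := ih (by omega)
    have hstep := hdec j (by omega) hj
    rw [Del] at hle ⊢
    rw [Finset.sum_Ico_succ_top hij, ← Finset.insert_Ico_right_eq_Ico_add_one hij,
      Finset.filter_insert]
    rw [delta] at hstep
    by_cases hjJ : j ∈ J
    · have hgap := hJ j hjJ hj
      rw [delta] at hgap
      rw [if_pos hjJ, Finset.card_insert_of_notMem (by simp)]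
      push_cast
      linarith
    · rw [if_neg hjJ]
      linarith
end

section
/- (Monotonicity of the gauge function φ.) Let λ_1 >_c λ_2 >_c ⋯ >_c λ_s be a strictly >_c-decreasing sequence of primary parts λ_i = (l_i, c_i) with l_i ≥ 1, and let I, J ⊆ {1,…,s} be subsets such that I, I+1, J partition {1,…,s}, l_i − l_{i+1} = δ(c_i, c_{i+1}) for all i ∈ I, and l_j − l_{j+1} ≥ 1 + δ(c_j, c_{j+1}) for all j ∈ J with j ≤ s−1. Define Δ(i,j) = Σ_{k=i}^{j−1} χ(c_k ≤ c_{k+1}) for i ≤ j and Δ(i,j) = −Δ(j,i) for i > j, α(i,j) = |[i,j) ∩ J| for i ≤ j and α(i,j) = −α(j,i) for i > j, and for (j,i) ∈ J × I with j < i set φ(j,i) = l_j − 2 l_{i+1} − Δ(j, i+1) − Δ(i+1−α(j,i), i+1). Then φ is decreasing in its first argument and increasing in its second argument: for j ≤ j' in J and i in I with j' < i, φ(j,i) ≥ φ(j',i); and for j in J and i ≤ i' in I with j < i, φ(j,i') ≥ φ(j,i). -/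
/-- α(i,j) = |[i,j) ∩ J| (for i ≤ j). -/
def alph (J : Finset ℕ) (i j : ℕ) : ℕ := ((Finset.Ico i j).filter (· ∈ J)).card

/-- The gauge function φ(j,i) = l_j − 2 l_{i+1} − Δ(j,i+1) − Δ(i+1−α(j,i), i+1). -/
def phi {m : ℕ} (l : ℕ → ℤ) (c : ℕ → Fin m) (J : Finset ℕ) (j i : ℕ) : ℤ :=
  l j - 2 * l (i + 1) - Del c j (i + 1) - Del c (i + 1 - alph J j i) (i + 1)

theorem delta_nonneg {m : ℕ} (p q : Fin m) : 0 ≤ delta p q := by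
  unfold delta
  split_ifs <;> norm_num

theorem delta_le_one {m : ℕ} (p q : Fin m) : delta p q ≤ 1 := by
  unfold delta
  split_ifs <;> norm_num

theorem Del_eq_sum_delta {m : ℕ} (c : ℕ → Fin m) (i j : ℕ) :
    Del c i j = ∑ k ∈ Finset.Ico i j, delta (c k) (c (k + 1)) := rfl

theorem Del_nonneg {m : ℕ} (c : ℕ → Fin m) (i j : ℕ) : 0 ≤ Del c i j :=
  Finset.sum_nonneg fun _ _ => delta_nonneg _ _

theorem Del_le_sub {m : ℕ} (c : ℕ → Fin m) {i j : ℕ} (hij : i ≤ j) :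
    Del c i j ≤ (j : ℤ) - i := by
  rw [Del_eq_sum_delta]
  calc _ ≤ ∑ _k ∈ Finset.Ico i j, (1 : ℤ) := Finset.sum_le_sum fun _ _ => delta_le_one _ _
    _ = (j : ℤ) - i := by simp [Nat.cast_sub hij]

theorem Del_add_Del {m : ℕ} (c : ℕ → Fin m) {i j k : ℕ} (hij : i ≤ j) (hjk : j ≤ k) :
    Del c i j + Del c j k = Del c i k :=
  Finset.sum_Ico_consecutive _ hij hjk

theorem alph_eq_sum (J : Finset ℕ) (i j : ℕ) :
    alph J i j = ∑ k ∈ Finset.Ico i j, if k ∈ J then 1 else 0 :=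
  Finset.card_filter _ _

theorem alph_le_sub (J : Finset ℕ) (i j : ℕ) : alph J i j ≤ j - i :=
  (Finset.card_filter_le _ _).trans_eq (Nat.card_Ico i j)

theorem alph_add_alph (J : Finset ℕ) {i j k : ℕ} (hij : i ≤ j) (hjk : j ≤ k) :
    alph J i j + alph J j k = alph J i k := by
  simp only [alph_eq_sum]
  exact Finset.sum_Ico_consecutive _ hij hjk

/-- The size drop along `[a, b)` exceeds `Del` by at least one for each element of `J`. -/
theorem Del_add_alph_le_sub {m s : ℕ} {l : ℕ → ℤ} {c : ℕ → Fin m} {J : Finset ℕ}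
    (hdec : ∀ k, 1 ≤ k → k + 1 ≤ s → l k - l (k + 1) ≥ delta (c k) (c (k + 1)))
    (hJ : ∀ j ∈ J, j + 1 ≤ s → l j - l (j + 1) ≥ 1 + delta (c j) (c (j + 1)))
    {a b : ℕ} (ha : 1 ≤ a) (hab : a ≤ b) (hb : b ≤ s) :
    Del c a b + alph J a b ≤ l a - l b := by
  rw [Del_eq_sum_delta, alph_eq_sum]
  induction b, hab using Nat.le_induction with
  | base => simp
  | succ b hab ih =>
    have ih := ih (by omega)
    rw [Finset.sum_Ico_succ_top hab, Finset.sum_Ico_succ_top hab]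
    push_cast at ih ⊢
    split_ifs with h
    · linarith [hJ b h hb]
    · linarith [hdec b (by omega) hb]

/-- Monotonicity of the gauge function φ: decreasing in its first argument (in J)
and increasing in its second argument (in I). -/
theorem phi_monotone (m : ℕ) (hm : 1 ≤ m) (s : ℕ) (l : ℕ → ℤ) (c : ℕ → Fin m)
    (I J : Finset ℕ)
    (hpos : ∀ k ∈ Finset.Icc 1 s, 1 ≤ l k)
    (hdec : ∀ k, 1 ≤ k → k + 1 ≤ s → l k - l (k + 1) ≥ delta (c k) (c (k + 1)))
    (hd1 : Disjoint I (I.image (· + 1))) (hd2 : Disjoint I J)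
    (hd3 : Disjoint (I.image (· + 1)) J)
    (hcover : I ∪ I.image (· + 1) ∪ J = Finset.Icc 1 s)
    (hI : ∀ i ∈ I, l i - l (i + 1) = delta (c i) (c (i + 1)))
    (hJ : ∀ j ∈ J, j + 1 ≤ s → l j - l (j + 1) ≥ 1 + delta (c j) (c (j + 1))) :
    (∀ j ∈ J, ∀ j' ∈ J, ∀ i ∈ I, j ≤ j' → j' < i → phi l c J j i ≥ phi l c J j' i) ∧
    (∀ j ∈ J, ∀ i ∈ I, ∀ i' ∈ I, i ≤ i' → j < i → phi l c J j i' ≥ phi l c J j i) := by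
  have hJ_pos : ∀ j ∈ J, 1 ≤ j := fun j hj =>
    (Finset.mem_Icc.1 (hcover ▸ Finset.mem_union_right _ hj)).1
  have hI_lt : ∀ i ∈ I, i + 1 ≤ s := fun i hi =>
    (Finset.mem_Icc.1 (hcover ▸ Finset.mem_union_left _
      (Finset.mem_union_right _ (Finset.mem_image_of_mem (· + 1) hi)))).2
  refine ⟨fun j hj j' _ i hi hjj' hj'i => ?_, fun j _ i hi i' hi' hii' hji => ?_⟩
  · have hs := hI_lt i hi
    have hdrop := Del_add_alph_le_sub hdec hJ (hJ_pos j hj) hjj' (by omega)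
    have hα := alph_add_alph J hjj' hj'i.le
    have hle := alph_le_sub J j i
    have hΔ := Del_add_Del c hjj' (show j' ≤ i + 1 by omega)
    have hΔ' := Del_add_Del c (show i + 1 - alph J j i ≤ i + 1 - alph J j' i by omega)
      (Nat.sub_le _ _)
    have hbound := Del_le_sub c (show i + 1 - alph J j i ≤ i + 1 - alph J j' i by omega)
    unfold phi
    omega
  · have hs := hI_lt i' hi'
    have hdrop := Del_add_alph_le_sub hdec hJ (show 1 ≤ i + 1 by omega)
      (show i + 1 ≤ i' + 1 by omega) hs
    have hα := alph_add_alph J hji.le hii'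
    have hle := alph_le_sub J i i'
    have hΔ := Del_add_Del c (show j ≤ i + 1 by omega) (show i + 1 ≤ i' + 1 by omega)
    have hΔ' := Del_add_Del c (Nat.sub_le (i + 1) (alph J j i)) (show i + 1 ≤ i' + 1 by omega)
    have hΔ'' := Del_add_Del c
      (show i + 1 - alph J j i ≤ i' + 1 - alph J j i' by omega) (Nat.sub_le _ _)
    have hnonneg := Del_nonneg c (i + 1 - alph J j i) (i' + 1 - alph J j i')
    unfold phi
    omega
end

section
/- (Part sizes' difference for a ≫_c-chain, first inequality.) Let s ≥ 1, let (l_k, c_k) for k ∈ {1,…,s} be primary parts with l_k ≥ 1, and let I, J ⊆ {1,…,s} be subsets such that I, I+1 = {i+1 : i ∈ I}, and J partition {1,…,s} and l_i = l_{i+1} + δ(c_i, c_{i+1}) for all i ∈ I. Form the sequence of parts in index order: the primary part (l_j, c_j) for each j ∈ J and the secondary part (l_{i+1}, c_i, c_{i+1}) for each i ∈ I, and assume that consecutive parts of this sequence satisfy the relation ≫_c. Define l'_k = l_k if k ∈ J and l'_k = 2 l_k if k ∈ I ∪ (I+1), Δ(k,k') = Σ_{t=k}^{k'−1} χ(c_t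 ≤ c_{t+1}) for k ≤ k', and β(k,k') = |(k,k'] ∩ J| for k ≤ k'. Then for all 1 ≤ k ≤ k' ≤ s, l'_k − l'_{k'} ≥ β(k,k') + Δ(k,k'). -/
/-- The part at index k of the assembled sequence: the primary part (l_k, c_k) if
k ∈ J, and the secondary part (l_{k+1}, c_k, c_{k+1}) if k ∈ I. -/
def partAt {m : ℕ} (l : ℕ → ℤ) (c : ℕ → Fin m) (J : Finset ℕ) (k : ℕ) : CPart m :=
  if k ∈ J then .primary (l k) (c k) else .secondary (l (k + 1)) (c k) (c (k + 1))

theorem Del_succ {m : ℕ} (c : ℕ → Fin m) {i j : ℕ} (h : i ≤ j) :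
    Del c i (j + 1) = Del c i j + delta (c j) (c (j + 1)) := by
  simp [Del, delta, Finset.sum_Ico_succ_top h]

theorem card_filter_Ioc_succ (J : Finset ℕ) {i j : ℕ} (h : i ≤ j) :
    (((Finset.Ioc i (j + 1)).filter (· ∈ J)).card : ℤ) =
      ((Finset.Ioc i j).filter (· ∈ J)).card + if j + 1 ∈ J then 1 else 0 := by
  have hIoc : Finset.Ioc i (j + 1) = insert (j + 1) (Finset.Ioc i j) := by
    ext x; simp only [Finset.mem_Ioc, Finset.mem_insert]; omega
  rw [hIoc, Finset.filter_insert]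
  split_ifs
  · rw [Finset.card_insert_of_notMem (by simp)]; push_cast; rfl
  · simp

/-- Part sizes' difference for a ≫_c-chain, first inequality:
l'_k − l'_{k'} ≥ β(k,k') + Δ(k,k') where l'_k = l_k for k ∈ J, l'_k = 2 l_k for
k ∈ I ∪ (I+1), and β(k,k') = |(k,k'] ∩ J|. -/
theorem chain_size_difference (m : ℕ) (hm : 1 ≤ m) (s : ℕ) (hs : 1 ≤ s)
    (l : ℕ → ℤ) (c : ℕ → Fin m) (I J : Finset ℕ)
    (hpos : ∀ k ∈ Finset.Icc 1 s, 1 ≤ l k)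
    (hd1 : Disjoint I (I.image (· + 1))) (hd2 : Disjoint I J)
    (hd3 : Disjoint (I.image (· + 1)) J)
    (hcover : I ∪ I.image (· + 1) ∪ J = Finset.Icc 1 s)
    (hI : ∀ i ∈ I, l i = l (i + 1) + delta (c i) (c (i + 1)))
    (hchainJ : ∀ j ∈ J, j + 1 ≤ s → gg (partAt l c J j) (partAt l c J (j + 1)))
    (hchainI : ∀ i ∈ I, i + 2 ≤ s → gg (partAt l c J i) (partAt l c J (i + 2))) :
    ∀ k k', 1 ≤ k → k ≤ k' → k' ≤ s →
      (if k ∈ J then l k else 2 * l k) - (if k' ∈ J then l k' else 2 * l k') ≥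
        ((((Finset.Ioc k k').filter (· ∈ J)).card : ℤ) + Del c k k') := by
  intro k k' hk hkk' hk's
  have mem_cases : ∀ t, 1 ≤ t → t ≤ s → t ∈ I ∨ (∃ i ∈ I, i + 1 = t) ∨ t ∈ J := by
    intro t h1 h2
    have : t ∈ I ∪ I.image (· + 1) ∪ J := hcover ▸ Finset.mem_Icc.2 ⟨h1, h2⟩
    simpa [or_assoc] using this
  have not_mem_J : ∀ i ∈ I, i ∉ J := fun i hi => Finset.disjoint_left.1 hd2 hi
  have succ_not_mem_J : ∀ i ∈ I, i + 1 ∉ J := fun i hi =>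
    Finset.disjoint_left.1 hd3 (Finset.mem_image_of_mem _ hi)
  have step : ∀ t, 1 ≤ t → t + 1 ≤ s →
      (if t ∈ J then l t else 2 * l t) - (if t + 1 ∈ J then l (t + 1) else 2 * l (t + 1)) ≥
        (if t + 1 ∈ J then 1 else 0) + delta (c t) (c (t + 1)) := by
    intro t h1 h2
    have hδ := delta_nonneg (c t) (c (t + 1))
    by_cases htI : t ∈ I
    · have := hI t htI
      simp only [not_mem_J t htI, succ_not_mem_J t htI, if_false]
      linarith
    have hsucc : t + 1 ∈ I ∨ t + 1 ∈ J := by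
      rcases mem_cases (t + 1) (by omega) h2 with h | ⟨i, hi, hit⟩ | h
      · exact Or.inl h
      · obtain rfl : i = t := by omega
        exact absurd hi htI
      · exact Or.inr h
    rcases mem_cases t h1 (by omega) with h | ⟨i, hi, rfl⟩ | htJ
    · exact absurd h htI
    · have hg := hchainI i hi h2
      have hiJ := not_mem_J i hi
      have hi1J := succ_not_mem_J i hi
      rcases hsucc with h | h
      · have hn := not_mem_J _ h
        have := hI _ h
        simp only [add_assoc, Nat.reduceAdd] at *
        simp only [partAt, hiJ, hi1J, hn, if_false, gg, add_assoc, Nat.reduceAdd] at hg ⊢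
        linarith
      · simp only [add_assoc, Nat.reduceAdd] at *
        simp only [partAt, hiJ, hi1J, h, if_false, if_true, gg, add_assoc, Nat.reduceAdd] at hg ⊢
        linarith
    · have hg := hchainJ t htJ h2
      rcases hsucc with h | h
      · have hn := not_mem_J _ h
        have := hI _ h
        simp only [partAt, htJ, hn, if_false, if_true, gg] at hg ⊢
        linarith
      · simp only [partAt, htJ, h, if_true, gg] at hg ⊢
        linarith
  induction k', hkk' using Nat.le_induction with
  | base => simp [Del]
  | succ n hn ih =>
    have := ih (by omega)
    have := step n (by omega) hk's
    rw [Del_succ c hn, card_filter_Ioc_succ J hn]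
    linarith
end

section
/- (Part sizes' difference for a ≫_c-chain, second inequality.) Let s ≥ 1, let (l_k, c_k) for k ∈ {1,…,s} be primary parts with l_k ≥ 1, and let I, J ⊆ {1,…,s} be subsets such that I, I+1 = {i+1 : i ∈ I}, and J partition {1,…,s} and l_i = l_{i+1} + δ(c_i, c_{i+1}) for all i ∈ I. Form the sequence of parts in index order: the primary part (l_j, c_j) for each j ∈ J and the secondary part (l_{i+1}, c_i, c_{i+1}) for each i ∈ I, and assume that consecutive parts of this sequence satisfy the relation ≫_c. Define Δ(k,k') = Σ_{t=k}^{k'−1} χ(c_t ≤ c_{t+1}) for k ≤ k'. Then for all i ≤ i' with i, i' ∈ I ∪ (I+1), one has l_i − l_{i'} ≥ Δ(i,i'). -/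
theorem delta_eq_zero_or_one {m : ℕ} (p q : Fin m) : delta p q = 0 ∨ delta p q = 1 := by
  unfold delta
  split_ifs <;> simp

theorem Del_self {m : ℕ} (c : ℕ → Fin m) (i : ℕ) : Del c i i = 0 := by
  simp [Del]

/-- Part sizes' difference for a ≫_c-chain, second inequality:
l_i − l_{i'} ≥ Δ(i,i') for i ≤ i' both in I ∪ (I+1). -/
theorem chain_size_difference_halves (m : ℕ) (hm : 1 ≤ m) (s : ℕ) (hs : 1 ≤ s)
    (l : ℕ → ℤ) (c : ℕ → Fin m) (I J : Finset ℕ)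
    (hpos : ∀ k ∈ Finset.Icc 1 s, 1 ≤ l k)
    (hd1 : Disjoint I (I.image (· + 1))) (hd2 : Disjoint I J)
    (hd3 : Disjoint (I.image (· + 1)) J)
    (hcover : I ∪ I.image (· + 1) ∪ J = Finset.Icc 1 s)
    (hI : ∀ i ∈ I, l i = l (i + 1) + delta (c i) (c (i + 1)))
    (hchainJ : ∀ j ∈ J, j + 1 ≤ s → gg (partAt l c J j) (partAt l c J (j + 1)))
    (hchainI : ∀ i ∈ I, i + 2 ≤ s → gg (partAt l c J i) (partAt l c J (i + 2))) :
    ∀ i ∈ I ∪ I.image (· + 1), ∀ i' ∈ I ∪ I.image (· + 1), i ≤ i' →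
      l i - l i' ≥ Del c i i' := by
  intro a ha b hb hab
  have mem_I_succ : ∀ i, i + 1 ∈ I.image (· + 1) ↔ i ∈ I := by simp
  have le_s : ∀ k, k ∈ I ∪ I.image (· + 1) → k ≤ s := fun k hk =>
    (Finset.mem_Icc.1 (hcover ▸ Finset.mem_union_left J hk)).2
  have one_le : ∀ k, k ∈ I ∪ I.image (· + 1) → 1 ≤ k := fun k hk =>
    (Finset.mem_Icc.1 (hcover ▸ Finset.mem_union_left J hk)).1
  have cases_mem : ∀ k, 1 ≤ k → k ≤ s → k ∈ I ∨ k ∈ I.image (· + 1) ∨ k ∈ J := by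
    intro k h1 h2
    have h : k ∈ I ∪ I.image (· + 1) ∪ J := hcover ▸ Finset.mem_Icc.2 ⟨h1, h2⟩
    simpa only [Finset.mem_union, or_assoc] using h
  have hIJ : ∀ k ∈ I, k ∉ J := fun k h => Finset.disjoint_left.1 hd2 h
  have hSJ : ∀ k ∈ I.image (· + 1), k ∉ J := fun k h => Finset.disjoint_left.1 hd3 h
  have hIS : ∀ k ∈ I, k ∉ I.image (· + 1) := fun k h => Finset.disjoint_left.1 hd1 h
  have next_mem : ∀ k, k ∉ I → k + 1 ≤ s → k + 1 ∈ I ∨ k + 1 ∈ J := by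
    intro k hk hks
    rcases cases_mem (k + 1) (by omega) hks with h | h | h
    · exact .inl h
    · exact absurd ((mem_I_succ k).1 h) hk
    · exact .inr h
  -- The factor 2 lets primary parts be compared with halves of secondary parts.
  have key : ∀ k, a ≤ k → k ≤ s →
      (k ∉ J → l a - l k ≥ Del c a k) ∧ (k ∈ J → 2 * l a - l k ≥ 2 * Del c a k) := by
    intro k hak
    induction k, hak using Nat.le_induction with
    | base =>
      intro _
      have haJ : a ∉ J := (Finset.mem_union.1 ha).elim (hIJ a) (hSJ a)
      simp [Del_self, haJ]
    | succ k hak ih =>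
      intro hks
      obtain ⟨ihI, ihJ⟩ := ih (by omega)
      rw [Del_succ c hak]
      have hδ := delta_eq_zero_or_one (c k) (c (k + 1))
      rcases cases_mem k ((one_le a ha).trans hak) (by omega) with hk | hk | hk
      · have h1 := ihI (hIJ k hk)
        have h2 := hI k hk
        have h3 := hSJ _ ((mem_I_succ k).2 hk)
        exact ⟨fun _ => by linarith, fun h => absurd h h3⟩
      · have h1 := ihI (hSJ k hk)
        have hkI : k ∉ I := fun h => hIS k h hk
        obtain ⟨i, hi, rfl⟩ := Finset.mem_image.1 hk
        have hg := hchainI i hi hks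
        rcases next_mem _ hkI hks with h | h
        · have h2 := hI _ h
          have h3 := hIJ _ h
          simp only [partAt, hIJ i hi, h3, if_false, gg, add_assoc, Nat.reduceAdd]
            at hg h2 h1 h3 ⊢ hδ
          exact ⟨fun _ => by linarith, fun h => absurd h h3⟩
        · simp only [partAt, hIJ i hi, h, if_true, if_false, gg, add_assoc, Nat.reduceAdd,
            not_true_eq_false, false_imp_iff, true_and, true_imp_iff] at hg h h1 ⊢ hδ
          omega
      · have h1 := ihJ hk
        have hg := hchainJ k hk hks
        rcases next_mem k (fun h => hIJ k h hk) hks with h | h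
        · have h2 := hI _ h
          have h3 := hIJ _ h
          simp only [partAt, hk, h3, if_true, if_false, gg] at hg
          exact ⟨fun _ => by omega, fun h => absurd h h3⟩
        · simp only [partAt, hk, h, if_true, gg] at hg
          exact ⟨fun h' => absurd h h', fun _ => by omega⟩
  exact (key b hab (le_s b hb)).1 ((Finset.mem_union.1 hb).elim (hIJ b) (hSJ b))
end
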